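/- arXiv:1612.02025 — 9 statements merged into one kernel-verified Lean document; each statement's English description precedes it below -/
import Mathlib

section
/- Let (M,d) be a metric space and λ > 0. If there exists a good-λ-embedding f : M → c₀, then there exists a map g : M → c₀ that is simultaneously a good-λ-embedding and a strict-λ-embedding. -/
open Metric Set ZeroAtInfty

/-- The gap of a set `E ⊆ M × M`: `inf {d(x,y) : (x,y) ∈ E}`. -/
noncomputable def pairGap {M : Type*} [MetricSpace M] (E : Set (M × M)) : ℝ :=
  sInf ((fun p : M × M => dist p.1 p.2) '' E)

/-- The diameter of a set `E ⊆ M × M`: `sup {d(x,y) : (x,y) ∈ E}`. -/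
noncomputable def pairDiam {M : Type*} [MetricSpace M] (E : Set (M × M)) : ℝ :=
  sSup ((fun p : M × M => dist p.1 p.2) '' E)

/-- `π(E) = π₁(E) × π₂(E)`, the smallest rectangle containing `E`. -/
def pairRect {M : Type*} (E : Set (M × M)) : Set (M × M) :=
  (Prod.fst '' E) ×ˢ (Prod.snd '' E)

/-- `Es` is a finite partition of `E` into nonempty pairwise disjoint pieces. -/
def IsPartition {α : Type*} {N : ℕ} (Es : Fin N → Set α) (E : Set α) : Prop :=
  (∀ n, (Es n).Nonempty) ∧ (⋃ n, Es n) = E ∧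
    ∀ i j : Fin N, i ≠ j → Disjoint (Es i) (Es j)

/-- Property `π(λ)`. -/
def PropertyPi (M : Type*) [MetricSpace M] (lam : ℝ) : Prop :=
  ∀ (a₁ a₂ : M) (r₁ r₂ : ℝ) (E : Set (M × M)),
    E.Nonempty → E ⊆ (closedBall a₁ r₁) ×ˢ (closedBall a₂ r₂) →
    lam * (r₁ + r₂) < pairGap E →
    ∃ (N : ℕ) (Es : Fin N → Set (M × M)), IsPartition Es E ∧
      ∀ n, pairDiam (Es n) < lam * pairGap (pairRect (Es n))

/-- A good-λ-embedding into `c₀`. -/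
def GoodEmbedding {M : Type*} [MetricSpace M] (lam : ℝ) (f : M → C₀(ℕ, ℝ)) : Prop :=
  (∀ n : ℕ, ∃ K : ℝ, K < lam ∧ ∀ x y : M, |f x n - f y n| ≤ K * dist x y) ∧
    ∀ x y : M, dist x y ≤ ‖f x - f y‖

/-- A strict-λ-embedding into `c₀`. -/
def StrictEmbedding {M : Type*} [MetricSpace M] (lam : ℝ) (f : M → C₀(ℕ, ℝ)) : Prop :=
  ∀ x y : M, x ≠ y → dist x y < ‖f x - f y‖ ∧ ‖f x - f y‖ < lam * dist x y

/-- A λ-embedding into `c₀`. -/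
def LambdaEmbedding {M : Type*} [MetricSpace M] (lam : ℝ) (f : M → C₀(ℕ, ℝ)) : Prop :=
  ∀ x y : M, dist x y ≤ ‖f x - f y‖ ∧ ‖f x - f y‖ ≤ lam * dist x y

/-- The gap between two subsets of `M`: `δ(U,V) = inf {d(u,v) : u ∈ U, v ∈ V}`. -/
noncomputable def setGap {M : Type*} [MetricSpace M] (U V : Set M) : ℝ :=
  sInf ((fun p : M × M => dist p.1 p.2) '' (U ×ˢ V))

theorem ZeroAtInftyContinuousMap.abs_apply_le_norm {α : Type*} [TopologicalSpace α]
    (f : C₀(α, ℝ)) (a : α) : |f a| ≤ ‖f‖ :=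
  f.toBCF.norm_coe_le_norm a

/-- The norm of a function vanishing at infinity is attained. -/
theorem ZeroAtInftyContinuousMap.exists_norm_eq_abs_apply {α : Type*} [TopologicalSpace α]
    [Nonempty α] (f : C₀(α, ℝ)) : ∃ a, ‖f‖ = |f a| := by
  obtain ⟨a, ha⟩ : ∃ a, ∀ b, |f b| ≤ |f a| := by
    by_cases hf : ∀ a, f a = 0
    · exact ⟨Classical.arbitrary α, fun b => by simp [hf]⟩
    · push Not at hf
      obtain ⟨a, ha⟩ := hf
      refine (map_continuous f).abs.exists_forall_ge' a ?_
      have h := (zero_at_infty f).abs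
      rw [abs_zero] at h
      exact (h.eventually_lt_const (abs_pos.mpr ha)).mono fun _ => le_of_lt
  exact ⟨a, le_antisymm ((f.toBCF.norm_le (abs_nonneg _)).mpr ha) (f.abs_apply_le_norm a)⟩

/-- Multiplication of a function vanishing at infinity by a bounded family of scalars, over a
discrete space. -/
noncomputable def ZeroAtInftyContinuousMap.boundedMul {α : Type*} [TopologicalSpace α]
    [DiscreteTopology α] (c : α → ℝ) (hc : ∃ C, ∀ a, |c a| ≤ C) (f : C₀(α, ℝ)) : C₀(α, ℝ) where
  toFun a := c a * f a
  continuous_toFun := continuous_of_discreteTopology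
  zero_at_infty' := by
    obtain ⟨C, hC⟩ := hc
    exact bdd_le_mul_tendsto_zero' C (Filter.Eventually.of_forall hC) (zero_at_infty f)

/-- A bound strictly below `lam` leaves room for a dilation by some factor in `(1, 2]`. -/
theorem exists_dilation_factor {lam K : ℝ} (hlam : 0 < lam) (hK : K < lam) :
    ∃ c : ℝ, 1 < c ∧ c ≤ 2 ∧ c * K < lam := by
  by_cases h : K ≤ lam / 3
  · exact ⟨2, by norm_num, le_rfl, by linarith⟩
  · push Not at h
    have hK0 : 0 < K := by linarith
    refine ⟨(K + lam) / (2 * K), ?_, ?_, ?_⟩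
    · rw [lt_div_iff₀ (by positivity)]; linarith
    · rw [div_le_iff₀ (by positivity)]; linarith
    · have : (K + lam) / (2 * K) * K = (K + lam) / 2 := by field_simp
      linarith

/-- In the upper estimate of a strict embedding, goodness suffices. -/
theorem GoodEmbedding.norm_sub_lt {M : Type*} [MetricSpace M] {lam : ℝ} {f : M → C₀(ℕ, ℝ)}
    (hf : GoodEmbedding lam f) {x y : M} (hxy : x ≠ y) : ‖f x - f y‖ < lam * dist x y := by
  obtain ⟨n, hn⟩ := (f x - f y).exists_norm_eq_abs_apply
  obtain ⟨K, hK, hKf⟩ := hf.1 n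
  rw [hn]
  exact (hKf x y).trans_lt (mul_lt_mul_of_pos_right hK (dist_pos.mpr hxy))

/-- If there exists a good-λ-embedding `f : M → c₀`, then there exists a map `g : M → c₀`
that is simultaneously a good-λ-embedding and a strict-λ-embedding. -/
theorem stmt0 {M : Type*} [MetricSpace M] (lam : ℝ) (hlam : 0 < lam)
    (h : ∃ f : M → C₀(ℕ, ℝ), GoodEmbedding lam f) :
    ∃ g : M → C₀(ℕ, ℝ), GoodEmbedding lam g ∧ StrictEmbedding lam g := by
  obtain ⟨f, hf⟩ := h
  choose K hK hKf using hf.1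
  choose c hc1 hc2 hcK using fun n => exists_dilation_factor hlam (hK n)
  have hc0 : ∀ n, 0 < c n := fun n => one_pos.trans (hc1 n)
  have hcb : ∃ C, ∀ n, |c n| ≤ C := ⟨2, fun n => (abs_of_pos (hc0 n)).trans_le (hc2 n)⟩
  let g : M → C₀(ℕ, ℝ) := fun x => (f x).boundedMul c hcb
  have hg : ∀ x y n, |g x n - g y n| = c n * |f x n - f y n| := fun x y n => by
    change |c n * f x n - c n * f y n| = _
    rw [← mul_sub, abs_mul, abs_of_pos (hc0 n)]
  have hlt : ∀ x y, x ≠ y → dist x y < ‖g x - g y‖ := fun x y hxy => by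
    obtain ⟨n, hn⟩ := (f x - f y).exists_norm_eq_abs_apply
    have hd := hf.2 x y
    rw [hn] at hd
    calc dist x y ≤ |f x n - f y n| := hd
      _ < c n * |f x n - f y n| :=
        lt_mul_of_one_lt_left ((dist_pos.mpr hxy).trans_le hd) (hc1 n)
      _ = |(g x - g y) n| := (hg x y n).symm
      _ ≤ ‖g x - g y‖ := (g x - g y).abs_apply_le_norm n
  have hgood : GoodEmbedding lam g := by
    refine ⟨fun n => ⟨c n * K n, hcK n, fun x y => ?_⟩, fun x y => ?_⟩
    · rw [hg, mul_assoc]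
      exact mul_le_mul_of_nonneg_left (hKf n x y) (hc0 n).le
    · rcases eq_or_ne x y with rfl | hxy
      · simp
      · exact (hlt x y hxy).le
  exact ⟨g, hgood, fun x y hxy => ⟨hlt x y hxy, hgood.norm_sub_lt hxy⟩⟩
end

section
/- Let (M,d) be a metric space, E a nonempty bounded subset of M × M, F a finite-dimensional real normed vector space, λ > 0 and ε > 0. Suppose P : M → F satisfies Lip(P) ≤ λ and d(x,y) ≤ ‖P(x) − P(y)‖ for every (x,y) ∈ E. Then there exists a finite partition {E₁, …, E_N} of E such that diam(Eₙ) < λ·δ(π(Eₙ)) + ε for each n. -/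
open Metric Set ZeroAtInfty

/-- The nonempty fibres over `E` of a map taking finitely many values on `E` partition `E`. -/
theorem exists_isPartition_of_finite_image {α β : Type*} {E : Set α} (c : α → β)
    (hc : (c '' E).Finite) :
    ∃ (N : ℕ) (Es : Fin N → Set α), IsPartition Es E ∧
      ∀ n, ∀ p ∈ Es n, ∀ q ∈ Es n, c p = c q := by
  have := hc.to_subtype
  obtain ⟨N, ⟨e⟩⟩ := Finite.exists_equiv_fin (c '' E)
  refine ⟨N, fun n => {p ∈ E | c p = e.symm n}, ⟨fun n => ?_, ?_, fun i j hij => ?_⟩, ?_⟩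
  · obtain ⟨p, hp, hpn⟩ := (e.symm n).2
    exact ⟨p, hp, hpn⟩
  · ext p
    simp only [mem_iUnion, mem_ofPred_eq]
    exact ⟨fun ⟨_, hp, _⟩ => hp, fun hp => ⟨e ⟨c p, p, hp, rfl⟩, hp, by simp⟩⟩
  · rw [Set.disjoint_left]
    rintro p ⟨_, hi⟩ ⟨_, hj⟩
    exact hij (e.symm.injective (Subtype.ext (hi.symm.trans hj)))
  · rintro n p ⟨_, hp⟩ q ⟨_, hq⟩
    exact hp.trans hq.symm

/-- A uniform comparison of the distances in `A` with those in its rectangular hull passes to the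
diameter and the gap. -/
theorem pairDiam_le_mul_pairGap_pairRect_add {M : Type*} [MetricSpace M] {A : Set (M × M)}
    (hA : A.Nonempty) {lam η : ℝ} (hlam : 0 < lam)
    (h : ∀ p ∈ A, ∀ q ∈ A, ∀ r ∈ A, dist p.1 p.2 ≤ lam * dist q.1 r.2 + η) :
    pairDiam A ≤ lam * pairGap (pairRect A) + η := by
  refine csSup_le (hA.image _) ?_
  rintro _ ⟨p, hp, rfl⟩
  have hgap : (dist p.1 p.2 - η) / lam ≤ pairGap (pairRect A) := by
    refine le_csInf (((hA.image _).prod (hA.image _)).image _) ?_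
    rintro _ ⟨⟨u, v⟩, ⟨⟨q, hq, rfl⟩, ⟨r, hr, rfl⟩⟩, rfl⟩
    rw [div_le_iff₀' hlam]
    linarith [h p hp q hq r hr]
  rw [div_le_iff₀' hlam] at hgap
  linarith

/-- Fact 2.1: if `P : M → F` (F finite dimensional) is λ-Lipschitz and expands distances on the
bounded set `E ⊆ M × M`, then `E` admits a finite partition with
`diam(Eₙ) < λ·δ(π(Eₙ)) + ε` for each piece. -/
theorem stmt1 {M : Type*} [MetricSpace M] {F : Type*} [NormedAddCommGroup F]
    [NormedSpace ℝ F] [FiniteDimensional ℝ F]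
    (E : Set (M × M)) (hne : E.Nonempty) (hbdd : Bornology.IsBounded E)
    (lam : ℝ) (hlam : 0 < lam) (ε : ℝ) (hε : 0 < ε)
    (P : M → F) (hLip : ∀ x y : M, ‖P x - P y‖ ≤ lam * dist x y)
    (hExp : ∀ p ∈ E, dist p.1 p.2 ≤ ‖P p.1 - P p.2‖) :
    ∃ (N : ℕ) (Es : Fin N → Set (M × M)), IsPartition Es E ∧
      ∀ n, pairDiam (Es n) < lam * pairGap (pairRect (Es n)) + ε := by
  have hP : LipschitzWith lam.toNNReal P := LipschitzWith.of_dist_le_mul fun x y => by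
    rw [dist_eq_norm, Real.coe_toNNReal _ hlam.le]
    exact hLip x y
  have := FiniteDimensional.proper ℝ F
  have htb : TotallyBounded (Prod.map P P '' E) :=
    (((hP.comp LipschitzWith.prod_fst).prodMk (hP.comp LipschitzWith.prod_snd)).isBounded_image
      hbdd).isCompact_closure.totallyBounded.subset subset_closure
  obtain ⟨t, ht, hcover⟩ := Metric.totallyBounded_iff.1 htb (ε / 5) (by positivity)
  have hcenter : ∀ p : M × M, ∃ y : F × F, p ∈ E → y ∈ t ∧ dist (Prod.map P P p) y < ε / 5 := by
    intro p
    by_cases hp : p ∈ E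
    · obtain ⟨y, hy, hpy⟩ := mem_iUnion₂.1 (hcover (mem_image_of_mem _ hp))
      exact ⟨y, fun _ => ⟨hy, hpy⟩⟩
    · exact ⟨0, fun h => absurd h hp⟩
  choose c hc using hcenter
  obtain ⟨N, Es, hEs, hfib⟩ := exists_isPartition_of_finite_image (E := E) c
    (ht.subset (image_subset_iff.2 fun p hp => (hc p hp).1))
  refine ⟨N, Es, hEs, fun n => ?_⟩
  have hsub : Es n ⊆ E := hEs.2.1 ▸ subset_iUnion Es n
  have hclose : ∀ p ∈ Es n, ∀ q ∈ Es n, dist (Prod.map P P p) (Prod.map P P q) < 2 * (ε / 5) := by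
    intro p hp q hq
    have h1 := (hc p (hsub hp)).2
    have h2 := (hc q (hsub hq)).2
    rw [← hfib n p hp q hq] at h2
    linarith [dist_triangle_right (Prod.map P P p) (Prod.map P P q) (c p)]
  have hdiam := pairDiam_le_mul_pairGap_pairRect_add (hEs.1 n) (η := 4 * (ε / 5)) hlam
    fun p hp q hq r hr => by
      have h1 : dist (P p.1) (P q.1) < 2 * (ε / 5) := (le_max_left _ _).trans_lt (hclose p hp q hq)
      have h2 : dist (P r.2) (P p.2) < 2 * (ε / 5) := (le_max_right _ _).trans_lt (hclose r hr p hp)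
      have h3 := hExp p (hsub hp)
      have h4 := hLip q.1 r.2
      rw [← dist_eq_norm] at h3 h4
      linarith [dist_triangle4 (P p.1) (P q.1) (P r.2) (P p.2)]
  linarith
end

section
/- Let (M,d) be a metric space and λ ≥ 1. If there exists a λ-embedding from M into c₀, then M has property weak-π(λ). -/
open Metric Set ZeroAtInfty

/-- Property weak-π(λ). -/
def PropertyWeakPi (M : Type*) [MetricSpace M] (lam : ℝ) : Prop :=
  ∀ (a₁ a₂ : M) (r₁ r₂ : ℝ) (E : Set (M × M)),
    E.Nonempty → E ⊆ (closedBall a₁ r₁) ×ˢ (closedBall a₂ r₂) →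
    lam * (r₁ + r₂) < pairGap E →
    ∃ (N : ℕ) (Fs : Fin N → Set (M × M)),
      (∀ n, (Fs n).Nonempty) ∧ (∀ n, IsClosed (Fs n)) ∧ E ⊆ ⋃ n, Fs n ∧
      ∀ n, r₁ + r₂ < pairGap (pairRect (Fs n))

/-- Coordinates of an element of `c₀` are bounded by its norm. -/
lemma abs_apply_le_norm (g : C₀(ℕ, ℝ)) (n : ℕ) : |g n| ≤ ‖g‖ := by
  rw [← ZeroAtInftyContinuousMap.norm_toBCF_eq_norm]
  exact g.toBCF.norm_coe_le_norm n

/-- Every nonnegative number below the norm is exceeded by some coordinate. -/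
lemma exists_lt_abs_apply (g : C₀(ℕ, ℝ)) {c : ℝ} (hc : 0 ≤ c) (h : c < ‖g‖) :
    ∃ n, c < |g n| := by
  by_contra! hn
  rw [← ZeroAtInftyContinuousMap.norm_toBCF_eq_norm] at h
  exact h.not_ge ((BoundedContinuousFunction.norm_le hc).2 hn)

/-- Only finitely many coordinates of an element of `c₀` exceed a positive threshold. -/
lemma finite_setOf_lt_abs_apply (g : C₀(ℕ, ℝ)) {c : ℝ} (hc : 0 < c) :
    {n | c < |g n|}.Finite := by
  have h := (zero_at_infty g).eventually (Metric.ball_mem_nhds 0 hc)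
  rw [Filter.cocompact_eq_cofinite, Filter.eventually_cofinite] at h
  refine h.subset fun n (hn : c < |g n|) => ?_
  simpa using hn.le

/-- If `|u x - u y| ≥ g` on a nonempty set `F`, while `u` varies by at most `η` on the first
projection of `F`, then the gap of the rectangle `π(F)` is at least `(g - η) / lam` for any
`lam`-Lipschitz `u`. -/
lemma le_pairGap_pairRect {M : Type*} [MetricSpace M] {lam g η : ℝ} (hlam : 0 < lam)
    {u : M → ℝ} (hu : ∀ x y, |u x - u y| ≤ lam * dist x y) {F : Set (M × M)}
    (hF : F.Nonempty) (hg : ∀ p ∈ F, g ≤ |u p.1 - u p.2|)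
    (hη : ∀ p ∈ F, ∀ q ∈ F, |u p.1 - u q.1| ≤ η) :
    (g - η) / lam ≤ pairGap (pairRect F) := by
  refine le_csInf (((hF.image _).prod (hF.image _)).image _) ?_
  rintro _ ⟨⟨_, _⟩, ⟨⟨p, hp, rfl⟩, ⟨q, hq, rfl⟩⟩, rfl⟩
  rw [div_le_iff₀' hlam]
  have h₁ := abs_sub_le (u q.1) (u p.1) (u q.2)
  linarith [hu p.1 q.2, hg q hq, hη q hq p hp]

/-- If `M` λ-embeds into `c₀` (λ ≥ 1), then `M` has property weak-π(λ). -/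
theorem stmt3 {M : Type*} [MetricSpace M] (lam : ℝ) (hlam : 1 ≤ lam)
    (h : ∃ f : M → C₀(ℕ, ℝ), LambdaEmbedding lam f) :
    PropertyWeakPi M lam := by
  obtain ⟨f, hf⟩ := h
  have hlam₀ : 0 < lam := by linarith
  have hlip (n : ℕ) (x y : M) : |f x n - f y n| ≤ lam * dist x y :=
    (abs_apply_le_norm (f x - f y) n).trans (hf x y).2
  have hcont (n : ℕ) : Continuous fun x => f x n :=
    (LipschitzWith.of_dist_le_mul (K := lam.toNNReal) fun x y => by
      rw [Real.coe_toNNReal _ hlam₀.le]; exact hlip n x y).continuous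
  intro a₁ a₂ r₁ r₂ E hE hEB hgap
  obtain ⟨⟨x₀, y₀⟩, hxy₀⟩ := hE
  have hr₁ : 0 ≤ r₁ := dist_nonneg.trans (hEB hxy₀).1
  have hr₂ : 0 ≤ r₂ := dist_nonneg.trans (hEB hxy₀).2
  obtain ⟨g, hg, hgE⟩ := exists_between hgap
  have hg₀ : 0 ≤ g := (by positivity : 0 ≤ lam * (r₁ + r₂)).trans hg.le
  obtain ⟨ε, hε, hεg⟩ : ∃ ε > 0, lam * (r₁ + r₂) < g - 2 * ε :=
    ⟨(g - lam * (r₁ + r₂)) / 4, by linarith, by linarith⟩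
  have hcover (n : ℕ) : ∃ t : Set ℝ, t.Finite ∧
      closedBall (f a₁ n) (lam * r₁) ⊆ ⋃ c ∈ t, ball c ε := by
    obtain ⟨t, -, ht⟩ := (isCompact_closedBall (f a₁ n) (lam * r₁)).finite_cover_balls hε
    exact ⟨t, ht⟩
  choose t htfin ht using hcover
  set I : Set ℕ := {n | g - lam * (r₁ + r₂) < |(f a₁ - f a₂) n|}
  have hI : I.Finite := finite_setOf_lt_abs_apply _ (by linarith)
  let F (n : ℕ) (c : ℝ) : Set (M × M) :=
    {p | f p.1 n ∈ closedBall c ε ∧ g ≤ |f p.1 n - f p.2 n|}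
  have hFclosed (n : ℕ) (c : ℝ) : IsClosed (F n c) :=
    (isClosed_closedBall.preimage ((hcont n).comp continuous_fst)).inter
      (isClosed_le continuous_const
        (((hcont n).comp continuous_fst).sub ((hcont n).comp continuous_snd)).abs)
  have hFgap (n : ℕ) (c : ℝ) (hF : (F n c).Nonempty) :
      r₁ + r₂ < pairGap (pairRect (F n c)) := by
    refine lt_of_lt_of_le ((lt_div_iff₀' hlam₀).2 hεg)
      (le_pairGap_pairRect hlam₀ (hlip n) hF (fun p hp => hp.2) fun p hp q hq => ?_)
    have h₁ := dist_triangle_right (f p.1 n) (f q.1 n) c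
    rw [Real.dist_eq] at h₁
    linarith [mem_closedBall.1 hp.1, mem_closedBall.1 hq.1]
  have hfin : ({S | S.Nonempty} ∩ ⋃ n ∈ I, F n '' t n).Finite :=
    (hI.biUnion fun n _ => (htfin n).image _).inter_of_right _
  obtain ⟨N, Fs, -, hFs⟩ := hfin.fin_param
  have hmem (k : Fin N) : (Fs k).Nonempty ∧ ∃ n c, F n c = Fs k := by
    have hk : Fs k ∈ range Fs := mem_range_self k
    rw [hFs] at hk
    obtain ⟨hne, hk⟩ := hk
    simp only [mem_iUnion] at hk
    obtain ⟨n, -, c, -, hc⟩ := hk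
    exact ⟨hne, n, c, hc⟩
  refine ⟨N, Fs, fun k => (hmem k).1, fun k => ?_, ?_, fun k => ?_⟩
  · obtain ⟨-, n, c, hc⟩ := hmem k
    exact hc ▸ hFclosed n c
  · rintro ⟨x, y⟩ hxy
    have hx : dist x a₁ ≤ r₁ := (hEB hxy).1
    have hy : dist y a₂ ≤ r₂ := (hEB hxy).2
    have hd : pairGap E ≤ dist x y :=
      csInf_le ⟨0, by rintro _ ⟨p, -, rfl⟩; exact dist_nonneg⟩ ⟨_, hxy, rfl⟩
    obtain ⟨n, hn⟩ := exists_lt_abs_apply (f x - f y) hg₀ (by linarith [(hf x y).1])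
    have hn' : g < |f x n - f y n| := hn
    have hxn : |f x n - f a₁ n| ≤ lam * r₁ := (hlip n x a₁).trans (by gcongr)
    have hyn : |f a₂ n - f y n| ≤ lam * r₂ :=
      (hlip n a₂ y).trans (by rw [dist_comm]; gcongr)
    have hnI : n ∈ I := by
      change g - lam * (r₁ + r₂) < |f a₁ n - f a₂ n|
      have h₁ := abs_sub_le (f x n) (f a₁ n) (f y n)
      have h₂ := abs_sub_le (f a₁ n) (f a₂ n) (f y n)
      linarith
    obtain ⟨c, hc, hxc⟩ := mem_iUnion₂.1 (ht n (show f x n ∈ _ from hxn))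
    have hF : (x, y) ∈ F n c := ⟨ball_subset_closedBall hxc, hn'.le⟩
    have hr : F n c ∈ range Fs := by
      rw [hFs]
      exact ⟨⟨_, hF⟩, mem_iUnion₂.2 ⟨n, hnI, mem_image_of_mem _ hc⟩⟩
    obtain ⟨k, hk⟩ := hr
    exact mem_iUnion.2 ⟨k, hk ▸ hF⟩
  · obtain ⟨hne, n, c, hc⟩ := hmem k
    rw [← hc] at hne ⊢
    exact hFgap n c hne
end

section
/- Every metric space (M,d) has property π(2). -/
open Metric Set ZeroAtInfty

/-- The nonempty fibres over `E` of a map with finite image on `E` partition `E`. -/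
theorem exists_isPartition_fibers {α β : Type*} {E : Set α} (k : α → β)
    (hk : (k '' E).Finite) :
    ∃ (N : ℕ) (Es : Fin N → Set α), IsPartition Es E ∧
      ∀ n, ∃ b, Es n = {p ∈ E | k p = b} := by
  have := hk.to_subtype
  let e := Finite.equivFin (k '' E)
  refine ⟨_, fun n => {p ∈ E | k p = (e.symm n : β)}, ⟨fun n => ?_, ?_, fun i j hij => ?_⟩,
    fun n => ⟨_, rfl⟩⟩
  · obtain ⟨p, hp, hpk⟩ := (e.symm n).2
    exact ⟨p, hp, hpk⟩
  · ext p
    simp only [mem_iUnion, mem_ofPred_eq, exists_and_left, and_iff_left_iff_imp]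
    intro hp
    exact ⟨e ⟨k p, mem_image_of_mem k hp⟩, by rw [Equiv.symm_apply_apply]⟩
  · rw [Set.disjoint_left]
    rintro p ⟨-, hi⟩ ⟨-, hj⟩
    exact hij (e.symm.injective (Subtype.ext (hi.symm.trans hj)))

theorem pairGap_le_dist {M : Type*} [MetricSpace M] {E : Set (M × M)} {p : M × M}
    (hp : p ∈ E) : pairGap E ≤ dist p.1 p.2 :=
  csInf_le ⟨0, by rintro _ ⟨q, -, rfl⟩; exact dist_nonneg⟩ (mem_image_of_mem _ hp)

/-- If `(x, y)` and `(x', y')` lie in a product of balls of radii `r₁`, `r₂` and have distances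
at least `m`, then `x` and `y'` are at distance at least `m - (r₁ + r₂)`. -/
theorem le_dist_of_mem_closedBall {M : Type*} [MetricSpace M] {a₁ a₂ x x' y y' : M}
    {r₁ r₂ m : ℝ} (hx : x ∈ closedBall a₁ r₁) (hx' : x' ∈ closedBall a₁ r₁)
    (hy : y ∈ closedBall a₂ r₂) (hy' : y' ∈ closedBall a₂ r₂)
    (h : m ≤ dist x y) (h' : m ≤ dist x' y') : m - (r₁ + r₂) ≤ dist x y' := by
  rw [mem_closedBall] at hx hx' hy hy'
  have h₁ := dist_triangle_right x' x a₁
  have h₂ := dist_triangle_right y' y a₂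
  have h₃ := dist_triangle x y' y
  have h₄ := dist_triangle x' x y'
  linarith

/-- Every metric space has property π(2). -/
theorem stmt6 (M : Type*) [MetricSpace M] : PropertyPi M 2 := by
  intro a₁ a₂ r₁ r₂ E _ hE hgap
  set η := pairGap E - 2 * (r₁ + r₂) with hη
  have hη0 : 0 < η / 2 := by linarith
  let k : M × M → ℕ := fun p => ⌊(dist p.1 p.2 - pairGap E) / (η / 2)⌋₊
  have hkE : (k '' E).Finite := by
    refine (Set.finite_Iic
      ⌊(r₁ + dist a₁ a₂ + r₂ - pairGap E) / (η / 2)⌋₊).subset ?_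
    rintro _ ⟨p, hp, rfl⟩
    have hx := mem_closedBall.1 (hE hp).1
    have hy := mem_closedBall'.1 (hE hp).2
    have := dist_triangle4 p.1 a₁ a₂ p.2
    refine mem_Iic.2 (Nat.floor_mono ?_)
    gcongr
    linarith
  obtain ⟨N, Es, hpart, hEs⟩ := exists_isPartition_fibers k hkE
  refine ⟨N, Es, hpart, fun n => ?_⟩
  obtain ⟨b, hb⟩ := hEs n
  have hne := hpart.1 n
  have hm0 : 0 ≤ b * (η / 2) := by positivity
  have hwin : ∀ p ∈ Es n, pairGap E + b * (η / 2) ≤ dist p.1 p.2 ∧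
      dist p.1 p.2 ≤ pairGap E + b * (η / 2) + η / 2 := by
    intro p hp
    rw [hb] at hp
    obtain ⟨hpE, hpb⟩ := hp
    have h0 := pairGap_le_dist hpE
    obtain ⟨hlo, hhi⟩ := (Nat.floor_eq_iff (div_nonneg (by linarith) hη0.le)).1 hpb
    rw [le_div_iff₀ hη0] at hlo
    rw [div_lt_iff₀ hη0] at hhi
    constructor <;> linarith
  have hdiam : pairDiam (Es n) ≤ pairGap E + b * (η / 2) + η / 2 := by
    refine csSup_le (hne.image _) ?_
    rintro _ ⟨p, hp, rfl⟩
    exact (hwin p hp).2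
  have hrect : pairGap E + b * (η / 2) - (r₁ + r₂) ≤ pairGap (pairRect (Es n)) := by
    refine le_csInf (((hne.image _).prod (hne.image _)).image _) ?_
    rintro _ ⟨⟨x, y'⟩, ⟨⟨p, hp, rfl⟩, ⟨q, hq, rfl⟩⟩, rfl⟩
    have hsub : Es n ⊆ E := hb ▸ sep_subset E _
    have hpE := hE (hsub hp)
    have hqE := hE (hsub hq)
    exact le_dist_of_mem_closedBall hpE.1 hqE.1 hpE.2 hqE.2 (hwin p hp).1 (hwin q hq).1
  linarith
end

section
/- Let 1 ≤ p < ∞ and let (Xₙ) be a sequence of finite-dimensional real normed spaces. Then the ℓᵖ-sum (⊕ₙ Xₙ)_p has property π(2^{1/p}). -/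
open Metric Set ZeroAtInfty

theorem exists_isPartition_of_totallyBounded {α β : Type*} [PseudoMetricSpace β] (g : α → β)
    {E : Set α} (hE : TotallyBounded (g '' E)) {ε : ℝ} (hε : 0 < ε) :
    ∃ (N : ℕ) (Es : Fin N → Set α), IsPartition Es E ∧
      ∀ n, ∀ u ∈ Es n, ∀ v ∈ Es n, dist (g u) (g v) < ε := by
  classical
  obtain ⟨t, -, ht, hcov⟩ := finite_approx_of_totallyBounded hE (ε / 2) (half_pos hε)
  have hc : ∀ u : E, ∃ y ∈ t, dist (g u) y < ε / 2 := fun u => by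
    simpa using hcov (mem_image_of_mem g u.2)
  choose c hct hcd using hc
  have hfin : (range c).Finite := ht.subset (range_subset_iff.2 hct)
  have := hfin.fintype
  let e := (Fintype.equivFin (range c)).symm
  refine ⟨Fintype.card (range c), fun n => (↑) '' (c ⁻¹' {(e n : β)}), ⟨?_, ?_, ?_⟩, ?_⟩
  · intro n
    obtain ⟨u, hu⟩ := (e n).2
    exact ⟨u, u, hu, rfl⟩
  · ext u
    simp only [mem_iUnion, mem_image, mem_preimage, mem_singleton_iff]
    constructor
    · rintro ⟨n, v, -, rfl⟩
      exact v.2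
    · intro hu
      exact ⟨e.symm ⟨c ⟨u, hu⟩, mem_range_self _⟩, ⟨u, hu⟩, by simp, rfl⟩
  · intro i j hij
    rw [Set.disjoint_left]
    rintro _ ⟨u, hu, rfl⟩ ⟨v, hv, huv⟩
    obtain rfl : v = u := Subtype.ext huv
    exact hij (e.injective (Subtype.ext (hu.symm.trans hv)))
  · rintro n _ ⟨u, hu, rfl⟩ _ ⟨v, hv, rfl⟩
    have hu' := hcd u
    have hv' := hcd v
    rw [mem_preimage, mem_singleton_iff] at hu hv
    rw [hu] at hu'
    rw [hv] at hv'
    linarith [dist_triangle_right (g u) (g v) (e n : β)]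

theorem exists_isPartition_pairDiam_lt {M F : Type*} [MetricSpace M] [PseudoMetricSpace F]
    [ProperSpace F] {P : M → F} (hP : LipschitzWith 1 P) {lam m : ℝ} (hlam : 0 ≤ lam) (hm : 0 < m)
    {E : Set (M × M)} (hE : Bornology.IsBounded E)
    (hdist : ∀ z ∈ E, dist z.1 z.2 + m ≤ lam * dist (P z.1) (P z.2)) :
    ∃ (N : ℕ) (Es : Fin N → Set (M × M)), IsPartition Es E ∧
      ∀ n, pairDiam (Es n) < lam * pairGap (pairRect (Es n)) := by
  let g : M × M → (F × F) × ℝ := fun z => ((P z.1, P z.2), dist z.1 z.2)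
  have hg : LipschitzWith 2 g :=
    (((hP.comp LipschitzWith.prod_fst).prodMk (hP.comp LipschitzWith.prod_snd)).prodMk
      LipschitzWith.dist).weaken (by norm_num)
  have htb : TotallyBounded (g '' E) :=
    (hg.isBounded_image hE).isCompact_closure.totallyBounded.subset subset_closure
  have hε : 0 < m / (3 + lam) := by positivity
  obtain ⟨N, Es, hpart, hclose⟩ := exists_isPartition_of_totallyBounded g htb hε
  refine ⟨N, Es, hpart, fun n => ?_⟩
  set ε := m / (3 + lam) with hεdef
  have hεm : 3 * ε + lam * ε = m := by rw [hεdef]; field_simp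
  have hsub : Es n ⊆ E := by
    rw [← hpart.2.1]
    exact subset_iUnion Es n
  have hcl : ∀ u ∈ Es n, ∀ v ∈ Es n, dist (P u.1) (P v.1) < ε ∧ dist (P u.2) (P v.2) < ε ∧
      dist (dist u.1 u.2) (dist v.1 v.2) < ε := by
    intro u hu v hv
    simpa [g, Prod.dist_eq, and_assoc] using hclose n u hu v hv
  obtain ⟨w, hw⟩ := hpart.1 n
  have hdiam : pairDiam (Es n) ≤ dist w.1 w.2 + ε := by
    refine csSup_le ((hpart.1 n).image _) ?_
    rintro _ ⟨u, hu, rfl⟩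
    have := (abs_lt.1 (hcl u hu w hw).2.2).2
    simp only
    linarith
  have hgap : dist w.1 w.2 + 2 * ε ≤ lam * pairGap (pairRect (Es n)) := by
    rw [pairGap, ← smul_eq_mul lam, ← Real.sInf_smul_of_nonneg hlam]
    refine le_csInf (((((hpart.1 n).image _).prod ((hpart.1 n).image _)).image _).smul_set) ?_
    rintro _ ⟨_, ⟨⟨x, y⟩, ⟨⟨u, hu, rfl⟩, ⟨v, hv, rfl⟩⟩, rfl⟩, rfl⟩
    have h1 := (abs_lt.1 (hcl u hu w hw).2.2).1
    have h2 := (hcl u hu v hv).2.1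
    have h3 := hdist u (hsub hu)
    have h4 : dist (P u.1) (P v.2) ≤ dist u.1 v.2 := by simpa using hP.dist_le_mul u.1 v.2
    have h5 := dist_triangle_right (P u.1) (P u.2) (P v.2)
    have h6 : dist (P u.1) (P u.2) ≤ dist u.1 v.2 + ε := by linarith
    have h7 := mul_le_mul_of_nonneg_left h6 hlam
    simp only [smul_eq_mul]
    linarith
  linarith

section lp

variable {ι : Type*} {X : ι → Type*} [∀ i, NormedAddCommGroup (X i)] {p : ENNReal}

/-- The restriction of an element of `lp X p` to a finite set of coordinates. -/
def lpRestrict (s : Finset ι) (f : lp X p) : PiLp p fun i : s => X i :=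
  WithLp.toLp p fun i => f i

variable [Fact (1 ≤ p)]

theorem norm_lpRestrict_sub_rpow (hp : p ≠ ⊤) (s : Finset ι) (f g : lp X p) :
    ‖lpRestrict s f - lpRestrict s g‖ ^ p.toReal = ∑ i ∈ s, ‖(f - g) i‖ ^ p.toReal := by
  have hp0 : 0 < p.toReal := ENNReal.toReal_pos (zero_lt_one.trans_le Fact.out).ne' hp
  rw [PiLp.norm_eq_sum hp0, one_div, Real.rpow_inv_rpow (by positivity) hp0.ne',
    ← Finset.sum_coe_sort s]
  rfl

theorem dist_rpow_eq_dist_lpRestrict_add [DecidableEq ι] (hp : p ≠ ⊤) (s : Finset ι)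
    (f g : lp X p) :
    dist f g ^ p.toReal = dist (lpRestrict s f) (lpRestrict s g) ^ p.toReal +
      ‖(f - g) - ∑ i ∈ s, lp.single p i ((f - g) i)‖ ^ p.toReal := by
  have hp0 : 0 < p.toReal := ENNReal.toReal_pos (zero_lt_one.trans_le Fact.out).ne' hp
  rw [dist_eq_norm, dist_eq_norm, norm_lpRestrict_sub_rpow hp, lp.norm_compl_sum_single hp0]
  ring

theorem lipschitzWith_lpRestrict (hp : p ≠ ⊤) (s : Finset ι) :
    LipschitzWith 1 (lpRestrict (X := X) (p := p) s) := by
  classical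
  have hp0 : 0 < p.toReal := ENNReal.toReal_pos (zero_lt_one.trans_le Fact.out).ne' hp
  refine LipschitzWith.of_dist_le_mul fun f g => ?_
  rw [NNReal.coe_one, one_mul, ← Real.rpow_le_rpow_iff dist_nonneg dist_nonneg hp0,
    dist_rpow_eq_dist_lpRestrict_add hp s f g]
  exact le_add_of_nonneg_right (by positivity)

theorem norm_sub_sum_single_le [DecidableEq ι] (hp : p ≠ ⊤) (s : Finset ι) (f : lp X p) :
    ‖f - ∑ i ∈ s, lp.single p i (f i)‖ ≤ ‖f‖ := by
  have hp0 : 0 < p.toReal := ENNReal.toReal_pos (zero_lt_one.trans_le Fact.out).ne' hp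
  rw [← Real.rpow_le_rpow_iff (norm_nonneg _) (norm_nonneg _) hp0, lp.norm_compl_sum_single hp0]
  exact sub_le_self _ (by positivity)

theorem norm_sub_sub_sum_single_le [DecidableEq ι] (hp : p ≠ ⊤) (s : Finset ι)
    (f g a b : lp X p) :
    ‖(f - g) - ∑ i ∈ s, lp.single p i ((f - g) i)‖ ≤
      dist f a + dist g b + ‖(a - b) - ∑ i ∈ s, lp.single p i ((a - b) i)‖ := by
  have key : (f - g) - ∑ i ∈ s, lp.single p i ((f - g) i) =
      ((f - a) - ∑ i ∈ s, lp.single p i ((f - a) i)) -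
      ((g - b) - ∑ i ∈ s, lp.single p i ((g - b) i)) +
      ((a - b) - ∑ i ∈ s, lp.single p i ((a - b) i)) := by
    simp only [lp.coeFn_sub, Pi.sub_apply, lp.single_sub, Finset.sum_sub_distrib]
    abel
  rw [key, dist_eq_norm, dist_eq_norm]
  refine (norm_add_le _ _).trans (add_le_add_left ((norm_sub_le _ _).trans ?_) _)
  exact add_le_add (norm_sub_sum_single_le hp s _) (norm_sub_sum_single_le hp s _)

end lp

theorem exists_one_lt_mul_le_of_rpow_le {q c : ℝ} (hq : 0 < q) (hc : 0 ≤ c)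
    (hc2 : (2 : ℝ) ^ (1 / q) * c < 1) :
    ∃ κ : ℝ, 1 < κ ∧ ∀ d u v : ℝ, 0 ≤ d → 0 ≤ u → 0 ≤ v → d ^ q = u ^ q + v ^ q → v ≤ c * d →
      κ * d ≤ (2 : ℝ) ^ (1 / q) * u := by
  have h2 : ((2 : ℝ) ^ (1 / q)) ^ q = 2 := by
    rw [one_div, Real.rpow_inv_rpow (by norm_num) hq.ne']
  have hcq : 2 * c ^ q < 1 := by
    have := Real.rpow_lt_rpow (by positivity) hc2 hq
    rwa [Real.mul_rpow (by positivity) hc, h2, Real.one_rpow] at this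
  have hk : 1 < 2 * (1 - c ^ q) := by linarith
  refine ⟨(2 * (1 - c ^ q)) ^ q⁻¹, Real.one_lt_rpow hk (by positivity), ?_⟩
  intro d u v hd hu hv hduv hvc
  have hk0 : 0 ≤ 2 * (1 - c ^ q) := by linarith
  rw [← Real.rpow_le_rpow_iff (by positivity) (by positivity) hq, Real.mul_rpow (by positivity) hd,
    Real.mul_rpow (by positivity) hu, h2, Real.rpow_inv_rpow hk0 hq.ne']
  have := Real.rpow_le_rpow hv hvc hq.le
  rw [Real.mul_rpow hc hd] at this
  linarith

/-- If `(Xₙ)` is a sequence of finite-dimensional normed spaces and `1 ≤ p < ∞`, then the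
ℓᵖ-sum `(⊕ₙ Xₙ)_p` has property π(2^(1/p)). -/
theorem stmt7 (p : ENNReal) [Fact (1 ≤ p)] (hp : p ≠ ⊤)
    (X : ℕ → Type*) [∀ n, NormedAddCommGroup (X n)] [∀ n, NormedSpace ℝ (X n)]
    [∀ n, FiniteDimensional ℝ (X n)] :
    PropertyPi (lp X p) ((2 : ℝ) ^ (1 / p.toReal)) := by
  classical
  intro a₁ a₂ r₁ r₂ E hne hsub hgap
  have hp0 : 0 < p.toReal := ENNReal.toReal_pos (zero_lt_one.trans_le Fact.out).ne' hp
  set lam := (2 : ℝ) ^ (1 / p.toReal) with hlam_def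
  have hlam : 0 < lam := by positivity
  set δ := pairGap E with hδ_def
  have hr : 0 ≤ r₁ + r₂ := by
    obtain ⟨z, hz⟩ := hne
    obtain ⟨h₁, h₂⟩ := hsub hz
    exact add_nonneg (dist_nonneg.trans (mem_closedBall.1 h₁))
      (dist_nonneg.trans (mem_closedBall.1 h₂))
  have hδ : 0 < δ := (by positivity : 0 ≤ lam * (r₁ + r₂)).trans_lt hgap
  have hδE : ∀ z ∈ E, δ ≤ dist z.1 z.2 := fun z hz =>
    csInf_le ⟨0, by rintro _ ⟨u, -, rfl⟩; exact dist_nonneg⟩ (mem_image_of_mem _ hz)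
  obtain ⟨t, hrt, htδ⟩ := exists_between ((lt_div_iff₀' hlam).2 hgap)
  rw [lt_div_iff₀' hlam] at htδ
  obtain ⟨s, hs⟩ := ((Metric.tendsto_nhds.1 (lp.hasSum_single hp (a₁ - a₂))) _
    (sub_pos.2 hrt)).exists
  rw [dist_comm, dist_eq_norm] at hs
  have hc : lam * (t / δ) < 1 := by rwa [← mul_div_assoc, div_lt_one hδ]
  obtain ⟨κ, hκ, hκd⟩ := exists_one_lt_mul_le_of_rpow_le hp0
    (div_nonneg (hr.trans hrt.le) hδ.le) hc
  refine exists_isPartition_pairDiam_lt (lipschitzWith_lpRestrict hp s) hlam.le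
    (mul_pos (sub_pos.2 hκ) hδ) ((isBounded_closedBall.prod isBounded_closedBall).subset hsub) ?_
  intro z hz
  obtain ⟨h₁, h₂⟩ := hsub hz
  rw [mem_closedBall] at h₁ h₂
  have hv := norm_sub_sub_sum_single_le hp s z.1 z.2 a₁ a₂
  have ht : t ≤ t / δ * dist z.1 z.2 := by
    rw [div_mul_eq_mul_div, le_div_iff₀ hδ]
    exact mul_le_mul_of_nonneg_left (hδE z hz) (hr.trans hrt.le)
  have := hκd _ _ _ dist_nonneg dist_nonneg (norm_nonneg _)
    (dist_rpow_eq_dist_lpRestrict_add hp s z.1 z.2) (by linarith)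
  have := mul_le_mul_of_nonneg_left (hδE z hz) (sub_pos.2 hκ).le
  linarith
end

section
/- Let (M,d) be a metric space in which every bounded subset is totally bounded. Then for every ε > 0 there exists a (1+ε)-embedding from M into c₀. -/
open Metric Set ZeroAtInfty

/-- A locally finite net: for every `r > 0` there is an `r`-dense set meeting each ball around `o`
in a finite set. -/
theorem exists_locallyFinite_net {M : Type*} [MetricSpace M]
    (h : ∀ s : Set M, Bornology.IsBounded s → TotallyBounded s) (o : M) {r : ℝ} (hr : 0 < r) :
    ∃ N : Set M, (∀ x, ∃ y ∈ N, dist x y ≤ r) ∧ N.Countable ∧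
      ∀ R : ℝ, (N ∩ {y | dist y o ≤ R}).Finite := by
  have hbdd : ∀ n : ℕ, Bornology.IsBounded {x : M | ⌊dist x o⌋₊ = n} := fun n =>
    (isBounded_closedBall (x := o) (r := n + 1)).subset fun x hx => by
      have hx' : ⌊dist x o⌋₊ = n := hx
      have := Nat.lt_floor_add_one (dist x o)
      rw [hx'] at this
      exact this.le
  choose t hts htf htc using fun n => finite_approx_of_totallyBounded (h _ (hbdd n)) r hr
  refine ⟨⋃ n, t n, fun x => ?_, countable_iUnion fun n => (htf n).countable, fun R => ?_⟩
  · have hx := htc ⌊dist x o⌋₊ (show x ∈ {y : M | ⌊dist y o⌋₊ = ⌊dist x o⌋₊} from rfl)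
    simp only [mem_iUnion, mem_ball] at hx
    obtain ⟨y, hy, hxy⟩ := hx
    exact ⟨y, mem_iUnion.2 ⟨_, hy⟩, hxy.le⟩
  · refine ((finite_Iic ⌊R⌋₊).biUnion fun n _ => htf n).subset ?_
    rintro y ⟨hy, hyR⟩
    obtain ⟨n, hn⟩ := mem_iUnion.1 hy
    have hn' : ⌊dist y o⌋₊ = n := hts n hn
    exact mem_biUnion (mem_Iic.2 (hn' ▸ Nat.floor_le_floor hyR)) hn

/-- For points `p, q`, a `lam`-Lipschitz function that separates `p` and `q` by `mu * dist p q`,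
is supported near `p` and `q`, and vanishes on a ball around `o` of radius proportional to
`dist p q`. -/
theorem exists_separating_bump {M : Type*} [MetricSpace M] (o p q : M) {lam mu δ : ℝ}
    (hmu : 0 < mu) (hle : mu ≤ lam) (hδ : mu ≤ lam * (1 - 2 * δ)) :
    ∃ g : M → ℝ, (∀ x y, |g x - g y| ≤ lam * dist x y) ∧ g q - g p = mu * dist p q ∧
      (∀ z, |g z| ≤ mu * dist p q) ∧
      ∀ z, g z ≠ 0 → δ * dist p q ≤ dist z o ∧ (dist z p ≤ dist p q ∨ dist z q ≤ dist p q) := by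
  have hlam : 0 < lam := hmu.trans_le hle
  have hd : 0 ≤ dist p q := dist_nonneg
  have hD : 0 ≤ mu * dist p q := by positivity
  obtain ⟨s, t, hs, ht, hst, hsu, htv⟩ : ∃ s t : ℝ, 0 ≤ s ∧ 0 ≤ t ∧ s + t = mu * dist p q ∧
      (0 < s → s ≤ lam * (dist p o - δ * dist p q)) ∧
      (0 < t → t ≤ lam * (dist q o - δ * dist p q)) := by
    have huv : mu * dist p q ≤
        lam * (dist p o - δ * dist p q) + lam * (dist q o - δ * dist p q) := by
      have h1 := mul_le_mul_of_nonneg_right hδ hd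
      have h2 := mul_le_mul_of_nonneg_left (dist_triangle_right p q o) hlam.le
      linarith
    generalize lam * (dist p o - δ * dist p q) = u at *
    generalize lam * (dist q o - δ * dist p q) = v at *
    generalize mu * dist p q = D at *
    rcases le_total u 0 with h0 | h0
    · exact ⟨0, D, le_rfl, hD, by ring, fun h => absurd h (lt_irrefl _), fun _ => by linarith⟩
    rcases le_total u D with h1 | h1
    · exact ⟨u, D - u, h0, by linarith, by ring, fun _ => le_rfl, fun _ => by linarith⟩
    · exact ⟨D, 0, hD, le_rfl, by ring, fun _ => h1, fun h => absurd h (lt_irrefl _)⟩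
  have hDle : mu * dist p q ≤ lam * dist p q := by gcongr
  have key : ∀ x y, (max (t - lam * dist x q) 0 - max (s - lam * dist x p) 0) -
      (max (t - lam * dist y q) 0 - max (s - lam * dist y p) 0) ≤ lam * dist x y := by
    intro x y
    have h0 : 0 ≤ lam * dist x y := by positivity
    have h1 := mul_le_mul_of_nonneg_left (dist_triangle_left y q x) hlam.le
    have h2 := mul_le_mul_of_nonneg_left (dist_triangle x y p) hlam.le
    have h3 := mul_le_mul_of_nonneg_left (dist_triangle4 p y x q) hlam.le
    rw [dist_comm p y, dist_comm y x] at h3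
    rcases max_cases (t - lam * dist x q) 0 with ⟨e1, _⟩ | ⟨e1, _⟩ <;>
    rcases max_cases (s - lam * dist x p) 0 with ⟨e2, _⟩ | ⟨e2, _⟩ <;>
    rcases max_cases (t - lam * dist y q) 0 with ⟨e3, _⟩ | ⟨e3, _⟩ <;>
    rcases max_cases (s - lam * dist y p) 0 with ⟨e4, _⟩ | ⟨e4, _⟩ <;>
    rw [e1, e2, e3, e4] <;> linarith
  refine ⟨fun z => max (t - lam * dist z q) 0 - max (s - lam * dist z p) 0,
    fun x y => abs_sub_le_iff.2 ⟨key x y, dist_comm x y ▸ key y x⟩, ?_, fun z => ?_, fun z hz => ?_⟩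
  · have h1 : max (t - lam * dist p q) 0 = 0 := max_eq_right (by linarith)
    have h2 : max (s - lam * dist q p) 0 = 0 := max_eq_right (by rw [dist_comm q p]; linarith)
    simp only [h1, h2, dist_self, mul_zero, sub_zero, max_eq_left hs, max_eq_left ht]
    linarith
  · have h1 : max (t - lam * dist z q) 0 ≤ t :=
      max_le (sub_le_self _ (by positivity)) ht
    have h2 : max (s - lam * dist z p) 0 ≤ s :=
      max_le (sub_le_self _ (by positivity)) hs
    have h3 := le_max_right (t - lam * dist z q) 0
    have h4 := le_max_right (s - lam * dist z p) 0
    exact abs_le.2 ⟨by linarith, by linarith⟩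
  · have aux : ∀ (a : M) (w : ℝ), w ≤ mu * dist p q →
        (0 < w → w ≤ lam * (dist a o - δ * dist p q)) → 0 < w - lam * dist z a →
        δ * dist p q ≤ dist z o ∧ dist z a ≤ dist p q := by
      intro a w hw hwu hpos
      have hza : 0 ≤ lam * dist z a := by positivity
      have hwu := hwu (by linarith)
      have h1 : dist z a ≤ dist a o - δ * dist p q :=
        le_of_mul_le_mul_left (by linarith) hlam
      have h2 := dist_triangle_left a o z
      exact ⟨by linarith, le_of_mul_le_mul_left (by linarith) hlam⟩
    by_cases hq : 0 < t - lam * dist z q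
    · exact (aux q t (by linarith) htv hq).imp_right Or.inr
    by_cases hp : 0 < s - lam * dist z p
    · exact (aux p s (by linarith) hsu hp).imp_right Or.inl
    · exact absurd (by simp only [max_eq_right (not_lt.1 hq), max_eq_right (not_lt.1 hp), sub_zero])
        hz

/-- A countable family of Lipschitz functions which is pointwise null and norming yields a
`lam`-embedding into `c₀`. -/
theorem exists_lambdaEmbedding_of_family {M : Type*} [MetricSpace M] {ι : Type*} [Countable ι]
    {lam : ℝ} (hlam : 0 ≤ lam) (F : ι → M → ℝ)
    (hF : ∀ i x y, |F i x - F i y| ≤ lam * dist x y)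
    (hfin : ∀ z, ∀ η > 0, {i | η ≤ |F i z|}.Finite)
    (hsep : ∀ x y, x ≠ y → ∃ i, dist x y ≤ |F i x - F i y|) :
    ∃ f : M → C₀(ℕ, ℝ), LambdaEmbedding lam f := by
  obtain ⟨e, he⟩ := exists_injective_nat ι
  have ht : ∀ z, Filter.Tendsto (Function.extend e (fun i => F i z) 0)
      (Filter.cocompact ℕ) (nhds 0) := by
    intro z
    rw [Filter.cocompact_eq_cofinite, Metric.tendsto_nhds]
    intro η hη
    refine ((hfin z η hη).image e).subset fun n hn => ?_
    by_cases hex : ∃ i, e i = n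
    · obtain ⟨i, rfl⟩ := hex
      refine ⟨i, ?_, rfl⟩
      simpa [he.extend_apply] using hn
    · exact absurd hη (by simpa [Function.extend_apply' _ _ _ hex] using hn)
  let f : M → C₀(ℕ, ℝ) := fun z => ⟨⟨_, continuous_of_discreteTopology⟩, ht z⟩
  have hf : ∀ z i, f z (e i) = F i z := fun z i =>
    he.extend_apply (fun i => F i z) (0 : ℕ → ℝ) i
  have hf' : ∀ z n, (¬∃ i, e i = n) → f z n = 0 := fun z n hn =>
    Function.extend_apply' (fun i => F i z) (0 : ℕ → ℝ) n hn
  refine ⟨f, fun x y => ⟨?_, ?_⟩⟩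
  · rcases eq_or_ne x y with rfl | hxy
    · simp
    obtain ⟨i, hi⟩ := hsep x y hxy
    have := (f x - f y).toBCF.norm_coe_le_norm (e i)
    rw [ZeroAtInftyContinuousMap.norm_toBCF_eq_norm] at this
    refine hi.trans (le_trans (le_of_eq ?_) this)
    rw [← hf x, ← hf y]
    rfl
  · rw [← ZeroAtInftyContinuousMap.norm_toBCF_eq_norm,
      BoundedContinuousFunction.norm_le (by positivity)]
    intro n
    change |f x n - f y n| ≤ _
    by_cases hex : ∃ i, e i = n
    · obtain ⟨i, rfl⟩ := hex
      rw [hf, hf]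
      exact hF i x y
    · rw [hf' x n hex, hf' y n hex]
      simpa using mul_nonneg hlam dist_nonneg

/-- If every bounded subset of `M` is totally bounded, then for every `ε > 0` there is a
`(1+ε)`-embedding from `M` into `c₀`. -/
theorem stmt9 {M : Type*} [MetricSpace M]
    (h : ∀ s : Set M, Bornology.IsBounded s → TotallyBounded s)
    (ε : ℝ) (hε : 0 < ε) :
    ∃ f : M → C₀(ℕ, ℝ), LambdaEmbedding (1 + ε) f := by
  rcases isEmpty_or_nonempty M with hM | ⟨⟨o⟩⟩
  · exact ⟨fun _ => 0, fun x => hM.elim x⟩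
  set lam := 1 + ε with hlam_def
  have hlam : 0 < lam := by positivity
  set mu := 1 + ε / 2 with hmu_def
  have hmu : 0 < mu := by positivity
  set δ := ε / (4 * lam) with hδ_def
  have hδ : 0 < δ := by positivity
  have hlδ : lam * δ = ε / 4 := by rw [hδ_def]; field_simp
  set θ := ε / (8 * lam) with hθ_def
  have hθ : 0 < θ := by positivity
  have hlθ : lam * θ = ε / 8 := by rw [hθ_def]; field_simp
  have hθ' : θ ≤ 1 / 8 := by
    rw [hθ_def, div_le_iff₀ (by positivity)]
    linarith
  choose N hdense hcount hNfin using fun k : ℤ =>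
    exists_locallyFinite_net h o (r := θ * 2 ^ k) (by positivity)
  choose g hLip hdiff hbound hsupp using fun p q : M =>
    exists_separating_bump o p q (lam := lam) (mu := mu) (δ := δ) hmu (by linarith)
      (by linarith)
  let I : Set (ℤ × M × M) := {i | (i.2.1 ∈ N i.1 ∧ i.2.2 ∈ N i.1) ∧
    (2 : ℝ) ^ i.1 ≤ 2 * dist i.2.1 i.2.2 ∧ dist i.2.1 i.2.2 ≤ 4 * 2 ^ i.1}
  have hI : I.Countable := by
    refine (countable_iUnion fun k : ℤ =>
      ((hcount k).prod (hcount k)).image (Prod.mk k)).mono ?_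
    rintro ⟨k, p, q⟩ hi
    exact mem_iUnion.2 ⟨k, (p, q), hi.1, rfl⟩
  have : Countable I := hI.to_subtype
  refine exists_lambdaEmbedding_of_family hlam.le (fun i : I => g i.1.2.1 i.1.2.2)
    (fun i => hLip _ _) (fun z η hη => ?_) (fun x y hxy => ?_)
  · obtain ⟨a, ha⟩ := exists_mem_Ico_zpow (x := η / (4 * mu)) (y := (2 : ℝ)) (by positivity)
      one_lt_two
    obtain ⟨b, hb⟩ := exists_mem_Ico_zpow (x := 2 * dist z o / δ + 1) (y := (2 : ℝ))
      (by positivity) one_lt_two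
    let R : ℤ → ℝ := fun k => dist z o + 8 * 2 ^ k
    refine Finite.of_finite_image (f := Subtype.val)
      (((finite_Icc a (b + 1)).biUnion fun k _ =>
        ((hNfin k (R k)).prod (hNfin k (R k))).image (Prod.mk k)).subset ?_)
      Subtype.val_injective.injOn
    rintro _ ⟨⟨⟨k, p, q⟩, ⟨hp, hq⟩, hk1, hk2⟩, hi, rfl⟩
    dsimp only at hp hq hk1 hk2
    have hi : η ≤ |g p q z| := hi
    have hne : g p q z ≠ 0 := fun h0 => by rw [h0, abs_zero] at hi; linarith
    obtain ⟨hz1, hz2⟩ := hsupp p q z hne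
    have hpq : dist p z ≤ 2 * dist p q ∧ dist q z ≤ 2 * dist p q := by
      have h1 := dist_triangle p q z
      have h2 := dist_triangle_left q z p
      rw [dist_comm z p, dist_comm z q] at hz2
      have h3 : 0 ≤ dist p q := dist_nonneg
      rcases hz2 with h4 | h4 <;> constructor <;> linarith
    have hp2 : dist p o ≤ R k := (dist_triangle p z o).trans (by simp only [R]; linarith)
    have hq2 : dist q o ≤ R k := (dist_triangle q z o).trans (by simp only [R]; linarith)
    refine mem_biUnion (x := k) ⟨?_, ?_⟩ ⟨(p, q), ⟨⟨hp, hp2⟩, hq, hq2⟩, rfl⟩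
    · have h1 : η / (4 * mu) ≤ 2 ^ k := by
        rw [div_le_iff₀ (by positivity)]
        have := mul_le_mul_of_nonneg_left hk2 hmu.le
        linarith [hbound p q z]
      exact (zpow_le_zpow_iff_right₀ (one_lt_two (α := ℝ))).1 (ha.1.trans h1)
    · have h1 : (2 : ℝ) ^ k ≤ 2 * dist z o / δ := by
        rw [le_div_iff₀ hδ]
        have := mul_le_mul_of_nonneg_right hk1 hδ.le
        linarith
      exact ((zpow_lt_zpow_iff_right₀ (one_lt_two (α := ℝ))).1
        (lt_of_le_of_lt h1 (by linarith [hb.2]))).le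
  · obtain ⟨k, hk1, hk2⟩ := exists_mem_Ico_zpow (dist_pos.2 hxy) (one_lt_two (α := ℝ))
    rw [zpow_add_one₀ two_ne_zero] at hk2
    obtain ⟨p, hp, hxp⟩ := hdense k x
    obtain ⟨q, hq, hyq⟩ := hdense k y
    have hpow : (0 : ℝ) < 2 ^ k := by positivity
    have hθk : θ * 2 ^ k ≤ 1 / 8 * 2 ^ k := by gcongr
    have h1 : dist x y ≤ dist x p + dist p q + dist y q := by
      rw [dist_comm y q]
      exact dist_triangle4 x p q y
    have h2 : dist p q ≤ dist x p + dist x y + dist y q := by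
      rw [dist_comm x p]
      exact dist_triangle4 p x y q
    refine ⟨⟨(k, p, q), ⟨hp, hq⟩, by dsimp only; linarith, by dsimp only; linarith⟩, ?_⟩
    have h3 := (abs_le.1 (hLip p q x p)).2
    have h4 := (abs_le.1 (hLip p q y q)).1
    have h5 := hdiff p q
    have h6 : dist x y ≤ g p q y - g p q x := by
      have e1 := mul_le_mul_of_nonneg_left hxp hlam.le
      have e2 := mul_le_mul_of_nonneg_left hyq hlam.le
      have e3 : mu * (dist x y - 2 * (θ * 2 ^ k)) ≤ mu * dist p q := by
        gcongr
        linarith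
      have e4 : (2 * (mu * θ) + 2 * (lam * θ)) * 2 ^ k ≤ ε / 2 * dist x y := by
        have : mu * θ ≤ lam * θ := by gcongr; linarith
        gcongr
        linarith
      have e5 : mu * dist x y = dist x y + ε / 2 * dist x y := by rw [hmu_def]; ring
      linarith
    rw [abs_sub_comm]
    exact h6.trans (le_abs_self _)
end

section
/- Every separable metric space (M,d) admits a strict-2-embedding into c₀; that is, there exists f : M → c₀ such that d(x,y) < ‖f(x) − f(y)‖ < 2·d(x,y) whenever x ≠ y. -/
open Metric Set ZeroAtInfty

/-- A finite family of real functions, each bounded on `E`, can be simultaneously approximated on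
`E` by finitely many points of `E`. -/
theorem exists_finite_net {P ι : Type*} [Finite ι] (φ : ι → P → ℝ) (E : Set P) (C : ℝ)
    (hC : ∀ p ∈ E, ∀ i, |φ i p| ≤ C) {η : ℝ} (hη : 0 < η) :
    ∃ T ⊆ E, T.Finite ∧ ∀ p ∈ E, ∃ q ∈ T, ∀ i, |φ i p - φ i q| < η := by
  have := Fintype.ofFinite ι
  have hb : Bornology.IsBounded ((fun p i => φ i p) '' E : Set (ι → ℝ)) := by
    refine (Metric.isBounded_closedBall (x := (0 : ι → ℝ)) (r := max C 0)).subset ?_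
    rintro _ ⟨p, hp, rfl⟩
    rw [Metric.mem_closedBall, dist_pi_le_iff (le_max_right _ _)]
    intro i
    simpa using Or.inl (hC p hp i)
  have htb : TotallyBounded ((fun p i => φ i p) '' E : Set (ι → ℝ)) :=
    TotallyBounded.subset subset_closure hb.isCompact_closure.totallyBounded
  obtain ⟨T, hTE, hTf, ht⟩ := exists_subset_image_finite_and.1
    (Metric.finite_approx_of_totallyBounded htb η hη)
  refine ⟨T, hTE, hTf, fun p hp => ?_⟩
  have := ht ⟨p, hp, rfl⟩
  simp only [mem_iUnion, mem_image, exists_prop, exists_exists_and_eq_and] at this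
  obtain ⟨q, hq, hpq⟩ := this
  refine ⟨q, hq, fun i => ?_⟩
  exact ((dist_pi_lt_iff hη).1 hpq i)

/-- A Lipschitz function dominated by `g` that separates `U` from `V` by at least `s`. -/
theorem exists_separating_function {M : Type*} [MetricSpace M] {U V : Set M}
    (hU : U.Nonempty) (hV : V.Nonempty) {K s σ τ : ℝ} (hK : 0 ≤ K) {g : M → ℝ}
    (hg : ∀ x y, g x ≤ g y + K * dist x y) (hg0 : ∀ x, 0 ≤ g x)
    (hσ : ∀ u ∈ U, σ ≤ g u) (hτ : ∀ v ∈ V, τ ≤ g v) (hs : s ≤ σ + τ)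
    (hsep : ∀ u ∈ U, ∀ v ∈ V, s ≤ K * dist u v) :
    ∃ f : M → ℝ, (∀ x y, |f x - f y| ≤ K * dist x y) ∧ (∀ x, |f x| ≤ g x) ∧
      ∀ u ∈ U, ∀ v ∈ V, s ≤ f u - f v := by
  have key : ∀ {W : Set M} {c : ℝ}, W.Nonempty → (∀ w ∈ W, c ≤ g w) →
      ∀ x, c ≤ g x + K * infDist x W := by
    intro W c hW hc x
    rcases hK.eq_or_lt with rfl | hK
    · obtain ⟨w, hw⟩ := hW
      linarith [hc w hw, hg w x]
    have : (c - g x) / K ≤ infDist x W := by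
      rw [le_infDist hW]
      intro w hw
      rw [div_le_iff₀ hK]
      rw [dist_comm, mul_comm]
      linarith [hc w hw, hg w x]
    rw [div_le_iff₀ hK] at this
    linarith
  have hlip : ∀ (W : Set M) (x y : M), K * infDist x W ≤ K * infDist y W + K * dist x y := by
    intro W x y
    rw [← mul_add]
    exact mul_le_mul_of_nonneg_left infDist_le_infDist_add_dist hK
  refine ⟨fun z => max (σ - K * infDist z U) (min 0 (K * infDist z V - τ)), fun x y => ?_,
    fun x => ?_, fun u hu v hv => ?_⟩
  · have aux : ∀ x y, max (σ - K * infDist x U) (min 0 (K * infDist x V - τ)) ≤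
        max (σ - K * infDist y U) (min 0 (K * infDist y V - τ)) + K * dist x y := by
      intro x y
      have h0 : 0 ≤ K * dist x y := by positivity
      have h1 := hlip U y x
      have h2 := hlip V x y
      rw [dist_comm y x] at h1
      rw [← max_add_add_right, ← min_add_add_right]
      exact max_le_max (by linarith) (min_le_min (by linarith) (by linarith))
    rw [abs_le]
    have h1 := aux x y
    have h2 := aux y x
    rw [dist_comm y x] at h2
    constructor <;> linarith
  · have h1 := key hU hσ x
    have h2 := key hV hτ x
    have h3 := hg0 x
    rw [abs_le]
    exact ⟨le_max_of_le_right (le_min (by linarith) (by linarith)),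
      max_le (by linarith) ((min_le_left _ _).trans h3)⟩
  · have h1 : s ≤ K * infDist v U := by
      rcases hK.eq_or_lt with rfl | hK
      · simpa using hsep u hu v hv
      have : s / K ≤ infDist v U := by
        rw [le_infDist hU]
        intro w hw
        rw [div_le_iff₀ hK]
        rw [dist_comm, mul_comm]
        exact hsep w hw v hv
      rw [div_le_iff₀ hK] at this
      linarith
    have h2 : σ ≤ max (σ - K * infDist u U) (min 0 (K * infDist u V - τ)) :=
      le_max_of_le_left (by simp [infDist_zero_of_mem hu])
    have h3 : max (σ - K * infDist v U) (min 0 (K * infDist v V - τ)) ≤ σ - s :=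
      max_le (by linarith) ((min_le_right _ _).trans (by simp [infDist_zero_of_mem hv]; linarith))
    linarith

/-- Finitely many Lipschitz functions, with constant `K < 2` and controlled by `h`, separate all
pairs of a bounded set `E` whose mutual distance dominates the distances to a finite set `S`. -/
theorem exists_finite_separating_family {M : Type*} [MetricSpace M] {S : Set M} (hS : S.Finite)
    {h ρ : M → ℝ} (hh : ∀ x y, h x ≤ h y + dist x y) (hh0 : ∀ x, 0 ≤ h x) {ε : ℝ} (hε : 0 < ε)
    (hρ : ∀ x, ∃ a ∈ S, dist x a + ε ≤ ρ x) (c : M) (R : ℝ) {E : Set (M × M)}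
    (hER : ∀ p ∈ E, dist p.1 c ≤ R ∧ dist p.2 c ≤ R)
    (hEh : ∀ p ∈ E, dist p.1 p.2 ≤ 2 * (h p.1 + h p.2))
    (hEρ : ∀ p ∈ E, 2 * (ρ p.1 + ρ p.2) ≤ dist p.1 p.2) :
    ∃ T : Set (M → ℝ), T.Finite ∧
      (∀ f ∈ T, (∃ K < 2, ∀ x y, |f x - f y| ≤ K * dist x y) ∧ ∀ x, |f x| ≤ 2 * (h x + ε)) ∧
      ∀ p ∈ E, ∃ f ∈ T, dist p.1 p.2 < f p.1 - f p.2 := by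
  rcases E.eq_empty_or_nonempty with rfl | ⟨p₀, hp₀⟩
  · exact ⟨∅, by simp⟩
  have hR : 0 ≤ R := dist_nonneg.trans (hER p₀ hp₀).1
  have := hS.to_subtype
  obtain ⟨D, hD⟩ : ∃ D, ∀ a ∈ S, dist a c ≤ D := by
    obtain ⟨D, hD⟩ := (hS.image (fun a => dist a c)).bddAbove
    exact ⟨D, fun a ha => hD ⟨a, ha, rfl⟩⟩
  let φ : (S ⊕ S) ⊕ Fin 3 → M × M → ℝ :=
    Sum.elim (Sum.elim (fun a p => dist p.1 a) (fun a p => dist p.2 a))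
      ![fun p => dist p.1 p.2, fun p => h p.1, fun p => h p.2]
  obtain ⟨T, hTE, hTf, hT⟩ := exists_finite_net φ E (max (R + D) (max (2 * R) (h c + R)))
    (by
      rintro p hp ((a | a) | i)
      · refine le_max_of_le_left ?_
        simp only [φ, Sum.elim_inl, abs_dist]
        linarith [dist_triangle_right p.1 a c, hD a a.2, (hER p hp).1]
      · refine le_max_of_le_left ?_
        simp only [φ, Sum.elim_inl, Sum.elim_inr, abs_dist]
        linarith [dist_triangle_right p.2 a c, hD a a.2, (hER p hp).2]
      · refine le_max_of_le_right ?_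
        fin_cases i
        · refine le_max_of_le_left ?_
          simp only [φ, Sum.elim_inr]
          simp only [Fin.zero_eta, Matrix.cons_val_zero, abs_dist]
          linarith [dist_triangle_right p.1 p.2 c, (hER p hp).1, (hER p hp).2]
        · refine le_max_of_le_right ?_
          simp only [φ, Sum.elim_inr]
          simp only [Fin.mk_one, Matrix.cons_val_one, Matrix.cons_val_zero, abs_of_nonneg (hh0 _)]
          linarith [hh p.1 c, (hER p hp).1]
        · refine le_max_of_le_right ?_
          simp only [φ, Sum.elim_inr]
          simp only [Fin.reduceFinMk, Matrix.cons_val, abs_of_nonneg (hh0 _)]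
          linarith [hh p.2 c, (hER p hp).2])
    (η := ε / 4) (by positivity)
  set K : ℝ := 2 * (2 * R + ε) / (2 * R + 2 * ε) with hKdef
  have hden : 0 < 2 * R + 2 * ε := by positivity
  have hK0 : 0 ≤ K := by positivity
  have hK2 : K < 2 := by
    rw [hKdef, div_lt_iff₀ hden]
    linarith
  have hKd : ∀ d ≤ 2 * R, d + ε ≤ K * (d / 2 + ε) := by
    intro d hd
    rw [hKdef, div_mul_eq_mul_div, le_div_iff₀ hden]
    nlinarith
  have main : ∀ q ∈ T, ∃ f : M → ℝ, (∀ x y, |f x - f y| ≤ K * dist x y) ∧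
      (∀ x, |f x| ≤ K * (h x + ε)) ∧
      ∀ p ∈ E, (∀ i, |φ i p - φ i q| < ε / 4) → dist p.1 p.2 < f p.1 - f p.2 := by
    intro q hq
    let G : Set (M × M) := {p ∈ E | ∀ i, |φ i p - φ i q| < ε / 4}
    have hqE := hTE hq
    have hqG : q ∈ G := ⟨hqE, fun i => by simpa using hε⟩
    have hqd : dist q.1 q.2 ≤ 2 * R := by
      linarith [dist_triangle_right q.1 q.2 c, (hER q hqE).1, (hER q hqE).2]
    have hGd : ∀ p ∈ G, |dist p.1 p.2 - dist q.1 q.2| < ε / 4 := fun p hp => hp.2 (Sum.inr 0)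
    have hG1 : ∀ p ∈ G, |h p.1 - h q.1| < ε / 4 := fun p hp => hp.2 (Sum.inr 1)
    have hG2 : ∀ p ∈ G, |h p.2 - h q.2| < ε / 4 := fun p hp => hp.2 (Sum.inr 2)
    obtain ⟨a, haS, ha⟩ := hρ q.1
    obtain ⟨b, hbS, hb⟩ := hρ q.2
    have hGa : ∀ p ∈ G, |dist p.1 a - dist q.1 a| < ε / 4 :=
      fun p hp => hp.2 (Sum.inl (Sum.inl ⟨a, haS⟩))
    have hGb : ∀ p ∈ G, |dist p.2 b - dist q.2 b| < ε / 4 :=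
      fun p hp => hp.2 (Sum.inl (Sum.inr ⟨b, hbS⟩))
    have hKq := hKd _ hqd
    obtain ⟨f, hf1, hf2, hf3⟩ := exists_separating_function (U := Prod.fst '' G)
      (V := Prod.snd '' G) (K := K) (s := dist q.1 q.2 + ε / 4) (σ := K * (h q.1 + ε - ε / 4))
      (τ := K * (h q.2 + ε - ε / 4)) (g := fun x => K * (h x + ε))
      ⟨_, q, hqG, rfl⟩ ⟨_, q, hqG, rfl⟩ hK0
      (fun x y => by
        rw [← mul_add]
        exact mul_le_mul_of_nonneg_left (by linarith [hh x y]) hK0)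
      (fun x => mul_nonneg hK0 (by linarith [hh0 x]))
      (by
        rintro _ ⟨p, hp, rfl⟩
        exact mul_le_mul_of_nonneg_left (by linarith [(abs_lt.1 (hG1 p hp)).1]) hK0)
      (by
        rintro _ ⟨p, hp, rfl⟩
        exact mul_le_mul_of_nonneg_left (by linarith [(abs_lt.1 (hG2 p hp)).1]) hK0)
      (by
        rw [← mul_add]
        have := mul_le_mul_of_nonneg_left (show dist q.1 q.2 / 2 + ε ≤
          h q.1 + ε - ε / 4 + (h q.2 + ε - ε / 4) by linarith [hEh q hqE]) hK0
        linarith)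
      (by
        rintro _ ⟨p, hp, rfl⟩ _ ⟨r, hr, rfl⟩
        have hpr : dist q.1 q.2 / 2 + ε ≤ dist p.1 r.2 := by
          have h1 := (abs_lt.1 (hGd p hp)).1
          have h2 := (abs_lt.1 (hGd r hr)).1
          have h3 := (abs_lt.1 (hGa p hp)).2
          have h4 := (abs_lt.1 (hGa r hr)).2
          have h5 := (abs_lt.1 (hGb p hp)).2
          have h6 := (abs_lt.1 (hGb r hr)).2
          have h7 := hEρ q hqE
          have h8 := dist_triangle p.1 r.2 p.2
          have h9 := dist_triangle_right r.2 p.2 b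
          have h10 := dist_triangle r.1 p.1 r.2
          have h11 := dist_triangle_right r.1 p.1 a
          linarith
        have := mul_le_mul_of_nonneg_left hpr hK0
        linarith)
    refine ⟨f, hf1, hf2, fun p hp hpq => ?_⟩
    have hpG : p ∈ G := ⟨hp, hpq⟩
    linarith [hf3 _ ⟨p, hpG, rfl⟩ _ ⟨p, hpG, rfl⟩, (abs_lt.1 (hGd p hpG)).2]
  choose! F hF1 hF2 hF3 using main
  refine ⟨F '' T, hTf.image F, ?_, fun p hp => ?_⟩
  · rintro _ ⟨q, hq, rfl⟩
    exact ⟨⟨K, hK2, hF1 q hq⟩, fun x => (hF2 q hq x).trans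
      (mul_le_mul_of_nonneg_right hK2.le (by linarith [hh0 x]))⟩
  · obtain ⟨q, hq, hpq⟩ := hT p hp
    exact ⟨F q, ⟨q, hq, rfl⟩, hF3 q hq p hp hpq⟩

/-- A countable family of Lipschitz functions with constants `< 2` that is pointwise null and
separates points strictly assembles to a strict 2-embedding into `c₀`. -/
theorem exists_strictEmbedding_of_family {M ι : Type*} [MetricSpace M] [Countable ι]
    (f : ι → M → ℝ) (hf : ∀ i, ∃ K < 2, ∀ x y, |f i x - f i y| ≤ K * dist x y)
    (h0 : ∀ x, ∀ ε > 0, {i | ε ≤ |f i x|}.Finite)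
    (hsep : ∀ x y, x ≠ y → ∃ i, dist x y < |f i x - f i y|) :
    ∃ F : M → C₀(ℕ, ℝ), StrictEmbedding 2 F := by
  obtain ⟨e, he⟩ := exists_injective_nat ι
  let g : M → ℕ → ℝ := fun x => Function.extend e (fun i => f i x) 0
  have hge : ∀ x i, g x (e i) = f i x := fun x i => he.extend_apply _ _ i
  have hg0 : ∀ x n, (¬ ∃ i, e i = n) → g x n = 0 := fun x n hn =>
    Function.extend_apply' _ _ _ hn
  have hg : ∀ x, Filter.Tendsto (g x) (Filter.cocompact ℕ) (nhds 0) := by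
    intro x
    rw [Filter.cocompact_eq_cofinite, Metric.tendsto_nhds]
    intro ε hε
    rw [Filter.eventually_cofinite]
    refine ((h0 x ε hε).image e).subset fun n hn => ?_
    by_cases hn' : ∃ i, e i = n
    · obtain ⟨i, rfl⟩ := hn'
      refine ⟨i, ?_, rfl⟩
      simpa [hge] using hn
    · simp [hg0 x n hn', not_le.2 hε] at hn
  let F : M → C₀(ℕ, ℝ) := fun x => ⟨⟨g x, continuous_of_discreteTopology⟩, hg x⟩
  have hF : ∀ x n, F x n = g x n := fun _ _ => rfl
  have hle : ∀ (u : C₀(ℕ, ℝ)) n, |u n| ≤ ‖u‖ := fun u n =>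
    u.toBCF.norm_coe_le_norm n
  refine ⟨F, fun x y hxy => ?_⟩
  obtain ⟨i, hi⟩ := hsep x y hxy
  have hd : 0 < dist x y := dist_pos.2 hxy
  have hlow : dist x y < ‖F x - F y‖ := by
    refine hi.trans_le ?_
    simpa [hF, hge] using hle (F x - F y) (e i)
  refine ⟨hlow, ?_⟩
  have hpt : ∀ n, |(F x - F y) n| < 2 * dist x y := by
    intro n
    rw [ZeroAtInftyContinuousMap.sub_apply, hF, hF]
    by_cases hn : ∃ i, e i = n
    · obtain ⟨i, rfl⟩ := hn
      obtain ⟨K, hK, hKf⟩ := hf i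
      rw [hge, hge]
      exact (hKf x y).trans_lt (mul_lt_mul_of_pos_right hK hd)
    · simp [hg0 _ n hn, hd]
  have hfin : {n | dist x y ≤ |(F x - F y) n|}.Finite := by
    have := (F x - F y).zero_at_infty'
    rw [Filter.cocompact_eq_cofinite, Metric.tendsto_nhds] at this
    have := this _ hd
    rw [Filter.eventually_cofinite] at this
    refine this.subset fun n hn => ?_
    simpa using hn
  obtain ⟨C, hC2, hC1, hC⟩ : ∃ C < 2 * dist x y, dist x y ≤ C ∧
      ∀ n ∈ {n | dist x y ≤ |(F x - F y) n|}, |(F x - F y) n| ≤ C := by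
    rcases Set.eq_empty_or_nonempty {n | dist x y ≤ |(F x - F y) n|} with h | h
    · exact ⟨dist x y, by linarith, le_rfl, fun n hn => (h ▸ hn : n ∈ (∅ : Set ℕ)).elim⟩
    · obtain ⟨m, hm, hmax⟩ := hfin.exists_maximalFor (fun n => |(F x - F y) n|) _ h
      refine ⟨_, hpt m, hm, fun n hn => ?_⟩
      by_contra! hlt
      exact absurd (hmax hn hlt.le) (not_le.2 hlt)
  refine lt_of_le_of_lt ?_ hC2
  refine (BoundedContinuousFunction.norm_le (f := (F x - F y).toBCF) (by linarith)).2 fun n => ?_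
  by_cases hn : dist x y ≤ |(F x - F y) n|
  · exact hC n hn
  · exact (not_le.1 hn).le.trans hC1

/-- Distance to the first `k + 1` points of the sequence `a`, modified so as to control distances
to `a 0` and to stay positive. -/
noncomputable def scaleDist {M : Type*} [MetricSpace M] (a : ℕ → M) (k : ℕ) (x : M) : ℝ :=
  max (infDist x (a '' Iic k)) (dist x (a 0) - k) + 1 / ((k : ℝ) + 1)

theorem scaleDist_nonneg {M : Type*} [MetricSpace M] (a : ℕ → M) (k : ℕ) (x : M) :
    0 ≤ scaleDist a k x :=
  add_nonneg (le_max_of_le_left infDist_nonneg) (by positivity)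

theorem scaleDist_le_add_dist {M : Type*} [MetricSpace M] (a : ℕ → M) (k : ℕ) (x y : M) :
    scaleDist a k x ≤ scaleDist a k y + dist x y := by
  have : max (infDist x (a '' Iic k)) (dist x (a 0) - k) ≤
      max (infDist y (a '' Iic k)) (dist y (a 0) - k) + dist x y := by
    rw [← max_add_add_right]
    exact max_le_max infDist_le_infDist_add_dist (by linarith [dist_triangle x y (a 0)])
  unfold scaleDist
  linarith

theorem tendsto_scaleDist {M : Type*} [MetricSpace M] {a : ℕ → M} (ha : DenseRange a) (x : M) :
    Filter.Tendsto (fun k => scaleDist a k x) Filter.atTop (nhds 0) := by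
  have h1 : Filter.Tendsto
      (fun k : ℕ => max (infDist x (a '' Iic k)) (dist x (a 0) - k)) Filter.atTop (nhds 0) := by
    rw [Metric.tendsto_nhds]
    intro ε hε
    obtain ⟨m, hm⟩ := ha.exists_dist_lt x hε
    obtain ⟨N, hN⟩ := exists_nat_gt (dist x (a 0))
    filter_upwards [Filter.eventually_ge_atTop m, Filter.eventually_ge_atTop N] with k hkm hkN
    have hkN' : (N : ℝ) ≤ k := by exact_mod_cast hkN
    rw [Real.dist_0_eq_abs, abs_of_nonneg (le_max_of_le_left infDist_nonneg)]
    exact max_lt ((infDist_le_dist_of_mem (mem_image_of_mem a (mem_Iic.2 hkm))).trans_lt hm)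
      (by linarith)
  simpa [scaleDist] using h1.add tendsto_one_div_add_atTop_nhds_zero_nat

theorem exists_dist_add_le_scaleDist {M : Type*} [MetricSpace M] (a : ℕ → M) (k : ℕ) (x : M) :
    ∃ b ∈ a '' Iic k, dist x b + 1 / ((k : ℝ) + 1) ≤ scaleDist a k x := by
  obtain ⟨b, hb, hxb⟩ := ((finite_Iic k).image a).isCompact.exists_infDist_eq_dist
    (nonempty_Iic.image a) x
  refine ⟨b, hb, ?_⟩
  rw [← hxb, scaleDist]
  gcongr
  exact le_max_left _ _

theorem dist_sub_le_scaleDist {M : Type*} [MetricSpace M] (a : ℕ → M) (k : ℕ) (x : M) :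
    dist x (a 0) - k ≤ scaleDist a k x :=
  (le_max_right _ _).trans (le_add_of_nonneg_right (by positivity))

/-- Every separable metric space strictly-2-embeds into `c₀`. -/
theorem stmt10 {M : Type*} [MetricSpace M] [TopologicalSpace.SeparableSpace M] :
    ∃ f : M → C₀(ℕ, ℝ), StrictEmbedding 2 f := by
  rcases isEmpty_or_nonempty M with hM | hM
  · exact ⟨fun _ => 0, fun x => hM.elim x⟩
  obtain ⟨a, ha⟩ := TopologicalSpace.exists_dense_seq M
  let E : ℕ → Set (M × M) := fun k => {p |
    dist p.1 p.2 ≤ 2 * (scaleDist a k p.1 + scaleDist a k p.2) ∧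
    2 * (scaleDist a (k + 1) p.1 + scaleDist a (k + 1) p.2) ≤ dist p.1 p.2}
  have hstage := fun k : ℕ => exists_finite_separating_family ((finite_Iic (k + 1)).image a)
    (scaleDist_le_add_dist a k) (scaleDist_nonneg a k)
    (show (0 : ℝ) < 1 / (((k + 1 : ℕ) : ℝ) + 1) by positivity)
    (exists_dist_add_le_scaleDist a (k + 1)) (a 0) (4 * ((k + 1 : ℕ) : ℝ)) (E := E k)
    (fun p hp => by
      have h1 := dist_sub_le_scaleDist a (k + 1) p.1
      have h2 := dist_sub_le_scaleDist a (k + 1) p.2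
      have h3 := dist_triangle_right p.1 p.2 (a 0)
      have h4 := hp.2
      have h5 : 0 ≤ dist p.1 (a 0) := dist_nonneg
      have h6 : 0 ≤ dist p.2 (a 0) := dist_nonneg
      constructor <;> linarith)
    (fun p hp => hp.1) (fun p hp => hp.2)
  choose T hTf hT hTE using hstage
  have hTc : ∀ k, Finite (T k) := fun k => (hTf k).to_subtype
  refine exists_strictEmbedding_of_family (ι := Σ k, T k) (fun i => i.2.1)
    (fun i => (hT i.1 i.2.1 i.2.2).1) (fun x ε hε => ?_) (fun x y hxy => ?_)
  · have hlim : Filter.Tendsto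
        (fun k : ℕ => 2 * (scaleDist a k x + 1 / (((k + 1 : ℕ) : ℝ) + 1)))
        Filter.atTop (nhds 0) := by
      simpa using ((tendsto_scaleDist ha x).add ((Filter.tendsto_add_atTop_iff_nat 1).2
        (tendsto_one_div_add_atTop_nhds_zero_nat (𝕜 := ℝ)))).const_mul 2
    obtain ⟨N, hN⟩ := Filter.eventually_atTop.1 (hlim.eventually_lt_const hε)
    have hfin : (⋃ k ∈ Iio N, range fun t : T k => (⟨k, t⟩ : Σ k, T k)).Finite :=
      (finite_Iio N).biUnion fun k _ => finite_range fun t : T k => (⟨k, t⟩ : Σ k, T k)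
    refine hfin.subset fun i hi => mem_biUnion (x := i.1) (mem_Iio.2 ?_) ⟨i.2, rfl⟩
    by_contra hiN
    have h1 := hN i.1 (not_lt.1 hiN)
    have h2 := (hT i.1 i.2.1 i.2.2).2 x
    have h3 : ε ≤ |i.2.1 x| := hi
    linarith
  · have hd : 0 < dist x y := dist_pos.2 hxy
    have hlim : Filter.Tendsto (fun k : ℕ => 2 * (scaleDist a k x + scaleDist a k y))
        Filter.atTop (nhds 0) := by
      simpa using ((tendsto_scaleDist ha x).add (tendsto_scaleDist ha y)).const_mul 2
    classical
    have hex : ∃ k, 2 * (scaleDist a k x + scaleDist a k y) < dist x y :=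
      (hlim.eventually_lt_const hd).exists
    obtain ⟨k, hk⟩ : ∃ k, (x, y) ∈ E k := by
      have hspec := Nat.find_spec hex
      rcases hn : Nat.find hex with _ | k
      · rw [hn] at hspec
        have h1 := dist_sub_le_scaleDist a 0 x
        have h2 := dist_sub_le_scaleDist a 0 y
        have h3 := dist_triangle_right x y (a 0)
        simp only [Nat.cast_zero] at h1 h2
        linarith
      · rw [hn] at hspec
        exact ⟨k, not_lt.1 (Nat.find_min hex (hn ▸ Nat.lt_succ_self k)), hspec.le⟩
    obtain ⟨f, hf, hxyf⟩ := hTE k _ hk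
    exact ⟨⟨k, f, hf⟩, hxyf.trans_le (le_abs_self _)⟩
end

section
/- Let 1 ≤ p < ∞ and let (Xₙ) be a sequence of finite-dimensional real normed spaces. Then the ℓᵖ-sum (⊕ₙ Xₙ)_p admits a strict-2^{1/p}-embedding into c₀; that is, there exists f : (⊕ₙ Xₙ)_p → c₀ such that ‖x − y‖ < ‖f(x) − f(y)‖ < 2^{1/p}·‖x − y‖ whenever x ≠ y. -/
open Metric Set ZeroAtInfty

open Filter Topology NNReal

theorem C0.exists_abs_apply_eq_norm (f : C₀(ℕ, ℝ)) : ∃ k, |f k| = ‖f‖ := by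
  have h0 : Tendsto (fun k => |f k|) (cocompact ℕ) (𝓝 0) := by
    simpa using f.zero_at_infty'.abs
  obtain ⟨k, hk⟩ : ∃ k, ∀ j, |f j| ≤ |f k| := by
    by_cases h : ∃ k, f k ≠ 0
    · obtain ⟨k, hk⟩ := h
      exact (continuous_of_discreteTopology (f := fun k => |f k|)).exists_forall_ge' k
        (h0.eventually_le_const (abs_pos.2 hk))
    · push Not at h
      exact ⟨0, by simp [h]⟩
  refine ⟨k, le_antisymm ?_ ?_⟩
  · simpa [ZeroAtInftyContinuousMap.norm_toBCF_eq_norm] using f.toBCF.norm_coe_le_norm k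
  · rw [← ZeroAtInftyContinuousMap.norm_toBCF_eq_norm]
    exact (BoundedContinuousFunction.norm_le (abs_nonneg _)).2 hk

theorem C0.abs_apply_le_norm (f : C₀(ℕ, ℝ)) (k : ℕ) : |f k| ≤ ‖f‖ := by
  simpa [ZeroAtInftyContinuousMap.norm_toBCF_eq_norm] using f.toBCF.norm_coe_le_norm k

theorem exists_strictEmbedding_of_coordinates {M : Type*} [MetricSpace M] {lam : ℝ}
    (g : ℕ → M → ℝ) (K : ℕ → ℝ≥0) (hK : ∀ k, (K k : ℝ) < lam)
    (hg : ∀ k, LipschitzWith (K k) (g k))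
    (h0 : ∀ x, Tendsto (fun k => g k x) atTop (𝓝 0))
    (hsep : ∀ x y, x ≠ y → ∃ k, dist x y ≤ |g k x - g k y|) :
    ∃ f : M → C₀(ℕ, ℝ), StrictEmbedding lam f := by
  have hc : ∀ k, ∃ c : ℝ, 1 < c ∧ c ≤ 2 ∧ c * K k < lam := fun k => by
    have h : Tendsto (fun c : ℝ => c * K k) (𝓝[>] 1) (𝓝 (1 * K k)) :=
      ((continuous_mul_const _).tendsto 1).mono_left nhdsWithin_le_nhds
    rw [one_mul] at h
    obtain ⟨c, hc, hc1, hc2⟩ := ((h.eventually_lt_const (hK k)).and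
      (Ioc_mem_nhdsGT one_lt_two)).exists
    exact ⟨c, hc1, hc2, hc⟩
  choose c hc1 hc2 hcK using hc
  refine ⟨fun x => ⟨⟨fun k => c k * g k x, continuous_of_discreteTopology⟩, ?_⟩, ?_⟩
  · rw [cocompact_eq_atTop]
    refine squeeze_zero_norm (a := fun k => 2 * |g k x|) (fun k => ?_) ?_
    · rw [Real.norm_eq_abs, abs_mul, abs_of_pos (one_pos.trans (hc1 k))]
      exact mul_le_mul_of_nonneg_right (hc2 k) (abs_nonneg _)
    · simpa using (h0 x).abs.const_mul 2
  · intro x y hxy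
    have hd : 0 < dist x y := dist_pos.2 hxy
    have hpos : ∀ k, 0 < c k := fun k => one_pos.trans (hc1 k)
    constructor
    · obtain ⟨k, hk⟩ := hsep x y hxy
      refine lt_of_lt_of_le ?_ (C0.abs_apply_le_norm _ k)
      change _ < |c k * g k x - c k * g k y|
      rw [← mul_sub, abs_mul, abs_of_pos (hpos k)]
      nlinarith [hc1 k]
    · obtain ⟨k, hk⟩ := C0.exists_abs_apply_eq_norm (_ - _)
      rw [← hk]
      change |c k * g k x - c k * g k y| < _
      rw [← mul_sub, abs_mul, abs_of_pos (hpos k)]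
      have := (hg k).dist_le_mul x y
      rw [Real.dist_eq] at this
      calc c k * |g k x - g k y| ≤ c k * (K k * dist x y) :=
            mul_le_mul_of_nonneg_left this (hpos k).le
        _ = c k * K k * dist x y := by ring
        _ < lam * dist x y := mul_lt_mul_of_pos_right (hcK k) hd

/-- Finitely many coordinates are attached to each level `n`, and they decay with `n`. -/
theorem exists_strictEmbedding_of_levels {M : Type*} [MetricSpace M] {lam : ℝ}
    (g : ℕ → ℕ → M → ℝ) (K : ℕ → ℕ → ℝ≥0) (hK : ∀ n i, (K n i : ℝ) < lam)
    (hg : ∀ n i, LipschitzWith (K n i) (g n i))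
    (hfin : ∀ n, ∃ N, ∀ i ≥ N, g n i = 0)
    (b : ℕ → M → ℝ) (hb : ∀ n i x, |g n i x| ≤ b n x)
    (hb0 : ∀ x, Tendsto (fun n => b n x) atTop (𝓝 0))
    (hsep : ∀ x y, x ≠ y → ∃ n i, dist x y ≤ |g n i x - g n i y|) :
    ∃ f : M → C₀(ℕ, ℝ), StrictEmbedding lam f := by
  refine exists_strictEmbedding_of_coordinates (fun k => g k.unpair.1 k.unpair.2)
    (fun k => K k.unpair.1 k.unpair.2) (fun k => hK _ _) (fun k => hg _ _) (fun x => ?_)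
    fun x y hxy => ?_
  · choose N hN using hfin
    rw [Metric.tendsto_nhds]
    intro e he
    obtain ⟨m, hm⟩ := eventually_atTop.1 ((hb0 x).eventually_lt_const he)
    rw [← Nat.cofinite_eq_atTop]
    refine Set.Finite.subset (((Set.finite_Iio m).biUnion
      fun n _ => ((Set.finite_Iio (N n)).image fun i => Nat.pair n i))) fun k hk => ?_
    have hk' : e ≤ |g k.unpair.1 k.unpair.2 x| := by simpa using hk
    simp only [Set.mem_iUnion]
    refine ⟨k.unpair.1, ?_, k.unpair.2, ?_, Nat.pair_unpair k⟩
    · by_contra! h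
      exact absurd (hm _ (by simpa using h)) (not_lt.2 (hk'.trans (hb _ _ _)))
    · by_contra! h
      rw [hN _ _ (by simpa using h)] at hk'
      simp at hk'
      linarith
  · obtain ⟨n, i, h⟩ := hsep x y hxy
    exact ⟨Nat.pair n i, by simpa using h⟩

/-- A Lipschitz function taking the values `a` on `U` and `-b` on `V`, and small where `h` is. -/
theorem exists_lipschitz_separating {M : Type*} [MetricSpace M] {K : ℝ≥0} {h : M → ℝ}
    (hh : LipschitzWith 1 h) (h_nonneg : ∀ x, 0 ≤ h x) {U V : Set M} (hU : U.Nonempty)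
    (hV : V.Nonempty) {a b e del : ℝ} (ha : 0 ≤ a) (hb : 0 ≤ b) (he : 0 ≤ e)
    (hdel : ∀ u ∈ U, ∀ v ∈ V, del ≤ dist u v) (hab : a + b ≤ K * del)
    (haU : ∀ u ∈ U, a ≤ K * h u + e) (hbV : ∀ v ∈ V, b ≤ K * h v + e) :
    ∃ g : M → ℝ, LipschitzWith K g ∧ (∀ u ∈ U, g u = a) ∧ (∀ v ∈ V, g v = -b) ∧
      ∀ z, |g z| ≤ K * h z + e := by
  have hK := K.coe_nonneg
  have key : ∀ {W : Set M} {w : ℝ}, W.Nonempty → (∀ u ∈ W, w ≤ K * h u + e) →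
      ∀ z, w - K * infDist z W ≤ K * h z + e := fun {W w} hW hw z => by
    refine le_of_forall_pos_le_add fun t ht => ?_
    obtain ⟨u, hu, hzu⟩ := (infDist_lt_iff (x := z) (r := infDist z W + t / (K + 1)) hW).1
      (by have : 0 < t / (K + 1) := by positivity
          linarith)
    have h1 := hw u hu
    have h2 : h u ≤ h z + dist z u := by
      have := hh.dist_le_mul u z
      rw [Real.dist_eq, dist_comm] at this
      have := le_abs_self (h u - h z)
      simp at *; linarith
    have h3 : K * dist z u ≤ K * (infDist z W + t / (K + 1)) :=
      mul_le_mul_of_nonneg_left hzu.le hK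
    have h4 : K * (t / (K + 1)) ≤ t := by
      rw [mul_div_assoc', div_le_iff₀ (by positivity)]; nlinarith
    nlinarith [mul_le_mul_of_nonneg_left h2 hK]
  refine ⟨fun z => max (a - K * infDist z U) (min 0 (K * infDist z V - b)), ?_, ?_, ?_, ?_⟩
  · have h1 : LipschitzWith K fun z => a - K * infDist z U := .of_le_add_mul K fun x y => by
      have := infDist_le_infDist_add_dist (s := U) (x := y) (y := x)
      rw [dist_comm] at this
      nlinarith
    have h2 : LipschitzWith K fun z => K * infDist z V - b := .of_le_add_mul K fun x y => by
      have := infDist_le_infDist_add_dist (s := V) (x := x) (y := y)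
      nlinarith
    simpa using h1.max (h2.const_min 0)
  · intro u hu
    simp [infDist_zero_of_mem hu, ha]
  · intro v hv
    have : del ≤ infDist v U := (le_infDist hU).2 fun u hu => by
      rw [dist_comm]; exact hdel u hu v hv
    have := mul_le_mul_of_nonneg_left this hK
    simp only [infDist_zero_of_mem hv, mul_zero, zero_sub]
    rw [min_eq_right (by linarith), max_eq_right (by linarith)]
  · intro z
    have := mul_nonneg hK (h_nonneg z)
    rw [abs_le]
    constructor
    · refine le_max_of_le_right (le_min (by linarith) ?_)
      linarith [key hV hbV z]
    · exact max_le (key hU haU z) ((min_le_left _ _).trans (by linarith))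

theorem exists_lipschitz_separating_of_close {M M' : Type*} [MetricSpace M]
    [PseudoMetricSpace M'] {lam : ℝ} (hlam : 1 < lam) {P : M → M'} (hP : LipschitzWith 1 P)
    {h : M → ℝ} (hh : LipschitzWith 1 h) (h_nonneg : ∀ x, 0 ≤ h x) {E : Set (M × M)}
    {e c t : ℝ} (ht : 0 < t) (htc : 3 * lam * t < c) (hte : 3 * lam * t < e)
    {x y : M} (hxy : (x, y) ∈ E)
    (hgap : dist x y + c ≤ lam * dist (P x) (P y))
    (hle : dist x y ≤ lam * (h x + h y) + e)
    (hEd : ∀ q ∈ E, dist q.1 q.2 ≤ dist x y + t)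
    (hE₁ : ∀ q ∈ E, dist (P q.1) (P x) ≤ t ∧ h x ≤ h q.1 + t)
    (hE₂ : ∀ q ∈ E, dist (P q.2) (P y) ≤ t ∧ h y ≤ h q.2 + t) :
    ∃ (K : ℝ≥0) (g : M → ℝ), K < lam ∧ LipschitzWith K g ∧ (∀ z, |g z| ≤ lam * h z + e) ∧
      ∀ q ∈ E, dist q.1 q.2 ≤ |g q.1 - g q.2| := by
  have hlt : t ≤ lam * t := le_mul_of_one_le_left ht.le hlam.le
  obtain ⟨K, hK1, hK2, hK3, hKlam⟩ : ∃ K : ℝ, dist x y + t < K * (dist (P x) (P y) - 2 * t) ∧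
      lam * (h x + h y) + 3 * lam * t - e < K * (h x + h y) ∧ 1 < K ∧ K < lam := by
    have hlim : ∀ w : ℝ, Tendsto (fun K : ℝ => K * w) (𝓝[<] lam) (𝓝 (lam * w)) := fun w =>
      ((continuous_mul_const w).tendsto lam).mono_left nhdsWithin_le_nhds
    exact (((hlim _).eventually_const_lt (by linarith)).and
      (((hlim _).eventually_const_lt (by linarith)).and (Ioo_mem_nhdsLT hlam))).exists
  lift K to ℝ≥0 using by linarith
  have hKt : K * t ≤ lam * t := mul_le_mul_of_nonneg_right hKlam.le ht.le
  have hnonneg : ∀ z, 0 ≤ K * (h z - t) + e := fun z => by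
    have := mul_nonneg K.coe_nonneg (h_nonneg z)
    nlinarith
  have hstep : ∀ {z w}, h z ≤ h w + t → K * (h z - t) + e ≤ K * h w + e := fun {z w} hzw => by
    nlinarith [K.coe_nonneg]
  set D := dist x y + t with hD
  have hD0 : 0 ≤ D := by positivity
  obtain ⟨g, hg, hgU, hgV, hgb⟩ := exists_lipschitz_separating (K := K) hh h_nonneg
    (U := Prod.fst '' E) (V := Prod.snd '' E) (a := min D (K * (h x - t) + e))
    (b := D - min D (K * (h x - t) + e)) (e := e) (del := dist (P x) (P y) - 2 * t)
    ⟨x, _, hxy, rfl⟩ ⟨y, _, hxy, rfl⟩ (le_min hD0 (hnonneg x))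
    (sub_nonneg.2 (min_le_left _ _)) (by nlinarith)
    (by
      rintro _ ⟨q, hq, rfl⟩ _ ⟨r, hr, rfl⟩
      have h1 := (hE₁ q hq).1
      have h2 := (hE₂ r hr).1
      have h3 := hP.dist_le_mul q.1 r.2
      have h4 := dist_triangle4 (P x) (P q.1) (P r.2) (P y)
      rw [dist_comm (P x) (P q.1)] at h4
      simp only [NNReal.coe_one, one_mul] at h3
      linarith)
    (by linarith)
    (by
      rintro _ ⟨q, hq, rfl⟩
      exact (min_le_right _ _).trans (hstep (hE₁ q hq).2))
    (by
      rintro _ ⟨q, hq, rfl⟩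
      refine le_trans ?_ (hstep (hE₂ q hq).2)
      rw [sub_le_comm]
      refine le_min (by linarith [hnonneg y]) ?_
      linarith)
  refine ⟨K, g, hKlam, hg, fun z => (hgb z).trans ?_, fun q hq => ?_⟩
  · linarith [mul_le_mul_of_nonneg_right hKlam.le (h_nonneg z)]
  · rw [hgU _ ⟨q, hq, rfl⟩, hgV _ ⟨q, hq, rfl⟩]
    refine (hEd q hq).trans (le_trans (le_of_eq ?_) (le_abs_self _))
    ring

theorem exists_finite_coordinates {M M' : Type*} [MetricSpace M]
    [PseudoMetricSpace M'] {lam : ℝ} (hlam : 1 < lam) {P : M → M'} (hP : LipschitzWith 1 P)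
    {h : M → ℝ} (hh : LipschitzWith 1 h) (h_nonneg : ∀ x, 0 ≤ h x) {E : Set (M × M)}
    {e c R : ℝ} (he : 0 < e) (hc : 0 < c)
    {C : Set M'} (hC : IsCompact C) (hEC : ∀ q ∈ E, P q.1 ∈ C ∧ P q.2 ∈ C)
    (hR : ∀ q ∈ E, dist q.1 q.2 ≤ R ∧ h q.1 ≤ R ∧ h q.2 ≤ R)
    (hgap : ∀ q ∈ E, dist q.1 q.2 + c ≤ lam * dist (P q.1) (P q.2))
    (hle : ∀ q ∈ E, dist q.1 q.2 ≤ lam * (h q.1 + h q.2) + e) :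
    ∃ (g : ℕ → M → ℝ) (K : ℕ → ℝ≥0), (∀ i, (K i : ℝ) < lam) ∧ (∀ i, LipschitzWith (K i) (g i)) ∧
      (∃ N, ∀ i ≥ N, g i = 0) ∧ (∀ i z, |g i z| ≤ lam * h z + e) ∧
      ∀ q ∈ E, ∃ i, dist q.1 q.2 ≤ |g i q.1 - g i q.2| := by
  obtain ⟨t, ht, htc, hte⟩ : ∃ t : ℝ, 0 < t ∧ 3 * lam * t < c ∧ 3 * lam * t < e := by
    have hpos : 0 < 3 * lam := by linarith
    refine ⟨min c e / 2 / (3 * lam), by positivity, ?_, ?_⟩ <;>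
      rw [mul_div_cancel₀ _ hpos.ne'] <;>
      linarith [min_le_left c e, min_le_right c e, lt_min hc he]
  let Φ : M × M → (M' × M') × (ℝ × ℝ × ℝ) := fun q =>
    ((P q.1, P q.2), (dist q.1 q.2, h q.1, h q.2))
  have hΦ : TotallyBounded (Φ '' E) := by
    refine TotallyBounded.subset ?_ ((hC.prod hC).prod
      (isCompact_Icc (a := (0 : ℝ × ℝ × ℝ)) (b := (R, R, R)))).totallyBounded
    rintro _ ⟨q, hq, rfl⟩
    obtain ⟨h1, h2, h3⟩ := hR q hq
    exact ⟨hEC q hq, ⟨dist_nonneg, h_nonneg _, h_nonneg _⟩, ⟨h1, h2, h3⟩⟩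
  obtain ⟨T, hT, hcov⟩ := Metric.totallyBounded_iff.1 hΦ (t / 2) (half_pos ht)
  have hpiece : ∀ w, ∃ (K : ℝ≥0) (g : M → ℝ), K < lam ∧ LipschitzWith K g ∧
      (∀ z, |g z| ≤ lam * h z + e) ∧
      ∀ q ∈ {q ∈ E | Φ q ∈ ball w (t / 2)}, dist q.1 q.2 ≤ |g q.1 - g q.2| := by
    intro w
    rcases Set.eq_empty_or_nonempty {q ∈ E | Φ q ∈ ball w (t / 2)} with hE | ⟨⟨x, y⟩, hxyE, hxyw⟩
    · refine ⟨0, 0, by simpa using by linarith, LipschitzWith.const 0, fun z => ?_,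
        by rw [hE]; exact fun q hq => hq.elim⟩
      have := h_nonneg z
      simp only [Pi.zero_apply, abs_zero]
      positivity
    · have hclose : ∀ q ∈ {q ∈ E | Φ q ∈ ball w (t / 2)}, dist (Φ q) (Φ (x, y)) ≤ t :=
        fun q hq => by
          have h1 := mem_ball.1 hq.2
          have h2 := mem_ball.1 hxyw
          linarith [dist_triangle_right (Φ q) (Φ (x, y)) w]
      simp only [Φ, Prod.dist_eq, max_le_iff] at hclose
      refine exists_lipschitz_separating_of_close hlam hP hh h_nonneg ht htc hte
        (x := x) (y := y) ⟨hxyE, hxyw⟩ (hgap _ hxyE) (hle _ hxyE) ?_ ?_ ?_ <;> intro q hq <;>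
        obtain ⟨⟨h1, h2⟩, h3, h4, h5⟩ := hclose q hq <;>
        rw [Real.dist_eq, abs_le] at h3 h4 h5
      · linarith
      · exact ⟨h1, by linarith⟩
      · exact ⟨h2, by linarith⟩
  choose K g hK hg hgb hgs using hpiece
  obtain ⟨N, s, -, rfl⟩ := hT.fin_param
  refine ⟨fun i => if hi : i < N then g (s ⟨i, hi⟩) else 0,
    fun i => if hi : i < N then K (s ⟨i, hi⟩) else 0, fun i => ?_, fun i => ?_,
    ⟨N, fun i hi => ?_⟩, fun i z => ?_, fun q hq => ?_⟩
  · dsimp only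
    split_ifs
    · exact hK _
    · simpa using by linarith
  · by_cases hi : i < N
    · simpa [hi] using hg _
    · simp [hi]
  · simp [hi.not_gt]
  · have := h_nonneg z
    dsimp only
    split_ifs
    · exact hgb _ z
    · simp only [Pi.zero_apply, abs_zero]
      positivity
  · obtain ⟨_, ⟨⟨i, hi⟩, rfl⟩, hqi⟩ := by simpa only [Set.mem_iUnion₂] using hcov ⟨q, hq, rfl⟩
    exact ⟨i, by simpa [hi] using hgs _ q ⟨hq, hqi⟩⟩

theorem exists_add_le_mul_of_rpow_le {r : ℝ} (hr : 1 ≤ r) {e R : ℝ} (he : 0 < e) :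
    ∃ c > 0, ∀ d A s : ℝ, 0 ≤ A → 0 ≤ s → d ≤ R → d ^ r ≤ A ^ r + s ^ r →
      (2 : ℝ) ^ (1 / r) * s + e < d → d + c ≤ (2 : ℝ) ^ (1 / r) * A := by
  have hr0 : 0 < r := by linarith
  set L : ℝ := (2 : ℝ) ^ (1 / r)
  have hL : 0 < L := by positivity
  have hLr : L ^ r = 2 := by
    rw [← Real.rpow_mul two_pos.le, one_div_mul_cancel hr0.ne', Real.rpow_one]
  rcases le_or_gt R 0 with hR | hR
  · exact ⟨1, one_pos, fun d A s hA hs hd _ h => by nlinarith [mul_nonneg hL.le hs]⟩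
  have hbase : 1 < 1 + (e / R) ^ r := by
    have : 0 < (e / R) ^ r := by positivity
    linarith
  set v : ℝ := (1 + (e / R) ^ r) ^ (1 / r)
  have hv : 1 < v := Real.one_lt_rpow hbase (by positivity)
  have hvr : v ^ r = 1 + (e / R) ^ r := by
    rw [← Real.rpow_mul (by linarith), one_div_mul_cancel hr0.ne', Real.rpow_one]
  refine ⟨(v - 1) * e, mul_pos (by linarith) he, fun d A s hA hs hd hdA hsd => ?_⟩
  have hLs : 0 ≤ L * s := by positivity
  have hd0 : 0 < d := by linarith
  have h1 : 2 * s ^ r + e ^ r ≤ d ^ r := by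
    calc 2 * s ^ r + e ^ r = (L * s) ^ r + e ^ r := by rw [Real.mul_rpow hL.le hs, hLr]
      _ ≤ (L * s + e) ^ r := Real.add_rpow_le_rpow_add hLs he.le hr
      _ ≤ d ^ r := Real.rpow_le_rpow (by positivity) hsd.le hr0.le
  have h2 : (d * e / R) ^ r ≤ e ^ r :=
    Real.rpow_le_rpow (by positivity) (by rw [div_le_iff₀ hR]; nlinarith) hr0.le
  have h3 : (v * d) ^ r ≤ (L * A) ^ r := by
    rw [Real.mul_rpow (by linarith) hd0.le, Real.mul_rpow hL.le hA, hvr, hLr]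
    rw [mul_div_assoc, Real.mul_rpow hd0.le (by positivity)] at h2
    linarith
  have h4 : v * d ≤ L * A := (Real.rpow_le_rpow_iff (by positivity) (by positivity) hr0).1 h3
  nlinarith

section Truncation

variable {p : ENNReal} [Fact (1 ≤ p)] {X : ℕ → Type*} [∀ n, NormedAddCommGroup (X n)]
  [∀ n, NormedSpace ℝ (X n)]

/-- The projection of an `ℓᵖ`-sum onto its first `n` coordinates. -/
noncomputable def lpTruncation (p : ENNReal) [Fact (1 ≤ p)] (X : ℕ → Type*)
    [∀ n, NormedAddCommGroup (X n)] [∀ n, NormedSpace ℝ (X n)] (n : ℕ) :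
    lp X p →L[ℝ] lp X p :=
  ∑ i ∈ Finset.range n,
    (lp.singleContinuousLinearMap ℝ X p i).comp (lp.evalCLM ℝ X p i)

theorem lpTruncation_apply (n : ℕ) (x : lp X p) :
    lpTruncation p X n x = ∑ i ∈ Finset.range n, lp.single p i (x i) := by
  simp [lpTruncation]
  rfl

theorem norm_rpow_eq_lpTruncation (hp : p ≠ ⊤) (n : ℕ) (x : lp X p) :
    ‖x‖ ^ p.toReal =
      ‖lpTruncation p X n x‖ ^ p.toReal + ‖x - lpTruncation p X n x‖ ^ p.toReal := by
  have hp0 : 0 < p.toReal := ENNReal.toReal_pos (one_pos.trans_le Fact.out).ne' hp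
  rw [lpTruncation_apply, lp.norm_sum_single hp0 (fun i => x i),
    ← lp.norm_sub_norm_compl_sub_single hp0 x]
  ring

theorem norm_lpTruncation_le (hp : p ≠ ⊤) (n : ℕ) (x : lp X p) :
    ‖lpTruncation p X n x‖ ≤ ‖x‖ := by
  have hp0 : 0 < p.toReal := ENNReal.toReal_pos (one_pos.trans_le Fact.out).ne' hp
  rw [← Real.rpow_le_rpow_iff (norm_nonneg _) (norm_nonneg _) hp0,
    norm_rpow_eq_lpTruncation hp n x]
  have := Real.rpow_nonneg (norm_nonneg (x - lpTruncation p X n x)) p.toReal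
  linarith

theorem norm_sub_lpTruncation_le (hp : p ≠ ⊤) (n : ℕ) (x : lp X p) :
    ‖x - lpTruncation p X n x‖ ≤ ‖x‖ := by
  have hp0 : 0 < p.toReal := ENNReal.toReal_pos (one_pos.trans_le Fact.out).ne' hp
  rw [← Real.rpow_le_rpow_iff (norm_nonneg _) (norm_nonneg _) hp0,
    norm_rpow_eq_lpTruncation hp n x]
  have := Real.rpow_nonneg (norm_nonneg (lpTruncation p X n x)) p.toReal
  linarith

theorem tendsto_lpTruncation (hp : p ≠ ⊤) (x : lp X p) :
    Tendsto (fun n => lpTruncation p X n x) atTop (𝓝 x) := by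
  simp only [lpTruncation_apply]
  exact (lp.hasSum_single hp x).tendsto_sum_nat

theorem isCompactOperator_lpTruncation [∀ n, FiniteDimensional ℝ (X n)] (n : ℕ) :
    IsCompactOperator (lpTruncation p X n) := by
  have h : ∀ i, IsCompactOperator
      ((lp.singleContinuousLinearMap ℝ X p i).comp (lp.evalCLM ℝ X p i)) := fun i => by
    have := FiniteDimensional.proper ℝ (X i)
    exact (isCompactOperator_of_locallyCompactSpace_dom (lp.evalCLM ℝ X p i)).clm_comp
      (lp.singleContinuousLinearMap ℝ X p i)
  exact Submodule.sum_mem (compactOperator (RingHom.id ℝ) (lp X p) (lp X p)) fun i _ => h i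

/-- The distance-like function measuring how badly `x` is approximated by its first `n`
coordinates; it also detects norms larger than `n`. -/
noncomputable def lpTail (n : ℕ) (x : lp X p) : ℝ :=
  max ‖x - lpTruncation p X n x‖ (‖x‖ - n)

theorem lpTail_nonneg (n : ℕ) (x : lp X p) : 0 ≤ lpTail n x :=
  (norm_nonneg _).trans (le_max_left _ _)

theorem lpTail_le_norm (hp : p ≠ ⊤) (n : ℕ) (x : lp X p) : lpTail n x ≤ ‖x‖ :=
  max_le (norm_sub_lpTruncation_le hp n x) (sub_le_self _ n.cast_nonneg)

theorem lipschitzWith_lpTail (hp : p ≠ ⊤) (n : ℕ) :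
    LipschitzWith 1 (lpTail n : lp X p → ℝ) := by
  have h1 : LipschitzWith 1 fun x : lp X p => ‖x - lpTruncation p X n x‖ :=
    .of_le_add fun x y => by
      have h := norm_sub_lpTruncation_le hp n (x - y)
      rw [map_sub] at h
      have h' := norm_sub_norm_le (x - lpTruncation p X n x) (y - lpTruncation p X n y)
      rw [sub_sub_sub_comm] at h'
      rw [dist_eq_norm]
      linarith
  have h2 : LipschitzWith 1 fun x : lp X p => ‖x‖ - n := .of_le_add fun x y => by
    rw [dist_eq_norm]
    linarith [norm_sub_norm_le x y]
  exact max_self (1 : ℝ≥0) ▸ h1.max h2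

theorem tendsto_lpTail (hp : p ≠ ⊤) (x : lp X p) :
    Tendsto (fun n => lpTail n x) atTop (𝓝 0) := by
  have h : Tendsto (fun n => ‖x - lpTruncation p X n x‖) atTop (𝓝 0) := by
    simpa using ((tendsto_lpTruncation hp x).const_sub x).norm
  refine h.congr' ?_
  filter_upwards [eventually_ge_atTop ⌈‖x‖⌉₊] with n hn
  exact (max_eq_left ((sub_nonpos.2 (Nat.ceil_le.1 hn)).trans (norm_nonneg _))).symm

/-- The pairs that are well separated by their first `n + 1` coordinates, but not by their first
`n` coordinates. -/
def lpLevel (p : ENNReal) [Fact (1 ≤ p)] (X : ℕ → Type*) [∀ n, NormedAddCommGroup (X n)]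
    [∀ n, NormedSpace ℝ (X n)] (lam : ℝ) (n : ℕ) : Set (lp X p × lp X p) :=
  {q | lam * (lpTail (n + 1) q.1 + lpTail (n + 1) q.2) + 1 / ((n + 1 : ℕ) + 1) < dist q.1 q.2 ∧
    dist q.1 q.2 ≤ lam * (lpTail n q.1 + lpTail n q.2) + 1 / (n + 1)}

theorem exists_mem_lpLevel (hp : p ≠ ⊤) {lam : ℝ} (hlam : 1 ≤ lam) {x y : lp X p}
    (hxy : x ≠ y) : ∃ n, (x, y) ∈ lpLevel p X lam n := by
  by_contra! hcon
  have hle : ∀ n : ℕ, dist x y ≤ lam * (lpTail n x + lpTail n y) + 1 / (n + 1) := by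
    intro n
    induction n with
    | zero =>
      have hx : ‖x‖ ≤ lpTail 0 x := le_max_of_le_right (by simp)
      have hy : ‖y‖ ≤ lpTail 0 y := le_max_of_le_right (by simp)
      have := dist_le_norm_add_norm x y
      have : 0 ≤ lpTail 0 x + lpTail 0 y := add_nonneg (lpTail_nonneg 0 x) (lpTail_nonneg 0 y)
      norm_num
      nlinarith
    | succ n ih =>
      by_contra! h
      exact hcon n ⟨h, ih⟩
  have hlim : Tendsto (fun n : ℕ => lam * (lpTail n x + lpTail n y) + 1 / ((n : ℝ) + 1)) atTop
      (𝓝 0) := by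
    simpa using (((tendsto_lpTail hp x).add (tendsto_lpTail hp y)).const_mul lam).add
      tendsto_one_div_add_atTop_nhds_zero_nat
  exact (dist_pos.2 hxy).not_ge (ge_of_tendsto' hlim hle)

theorem norm_add_norm_le_of_mem_lpLevel {lam : ℝ} (hlam : 1 < lam) {n : ℕ}
    {q : lp X p × lp X p} (hq : q ∈ lpLevel p X lam n) :
    ‖q.1‖ + ‖q.2‖ ≤ 2 * lam * (n + 1) / (lam - 1) := by
  have h1 : ‖q.1‖ - (n + 1 : ℕ) ≤ lpTail (n + 1) q.1 := le_max_right _ _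
  have h2 : ‖q.2‖ - (n + 1 : ℕ) ≤ lpTail (n + 1) q.2 := le_max_right _ _
  have h3 := hq.1
  have h4 : (0 : ℝ) < 1 / ((n + 1 : ℕ) + 1) := by positivity
  have h5 := dist_le_norm_add_norm q.1 q.2
  rw [le_div_iff₀ (by linarith)]
  push_cast at *
  nlinarith

theorem exists_add_le_mul_dist_lpTruncation (hp : p ≠ ⊤) (n : ℕ) :
    ∃ c > 0, ∀ q ∈ lpLevel p X ((2 : ℝ) ^ (1 / p.toReal)) n, dist q.1 q.2 + c ≤
      (2 : ℝ) ^ (1 / p.toReal) *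
        dist (lpTruncation p X (n + 1) q.1) (lpTruncation p X (n + 1) q.2) := by
  have hp1 : 1 ≤ p.toReal := by
    simpa using ENNReal.toReal_mono hp (Fact.out : 1 ≤ p)
  set lam : ℝ := (2 : ℝ) ^ (1 / p.toReal) with hlam_def
  have hlam : 1 < lam := Real.one_lt_rpow one_lt_two (by positivity)
  obtain ⟨c, hc, h⟩ := exists_add_le_mul_of_rpow_le hp1 (R := 2 * lam * (n + 1) / (lam - 1))
    (e := 1 / ((n + 1 : ℕ) + 1)) (by positivity)
  refine ⟨c, hc, fun q hq => ?_⟩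
  have hR := (dist_le_norm_add_norm q.1 q.2).trans (norm_add_norm_le_of_mem_lpLevel hlam hq)
  set P := lpTruncation p X (n + 1)
  have hs : ‖q.1 - q.2 - P (q.1 - q.2)‖ ≤ lpTail (n + 1) q.1 + lpTail (n + 1) q.2 := by
    rw [map_sub, sub_sub_sub_comm]
    exact (norm_sub_le _ _).trans (add_le_add (le_max_left _ _) (le_max_left _ _))
  refine h _ _ _ dist_nonneg (norm_nonneg (q.1 - q.2 - P (q.1 - q.2))) hR ?_
    (lt_of_le_of_lt ?_ hq.1)
  · rw [dist_eq_norm, dist_eq_norm, ← map_sub]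
    exact (norm_rpow_eq_lpTruncation hp (n + 1) _).le
  · have := mul_le_mul_of_nonneg_left hs (one_pos.trans hlam).le
    linarith

end Truncation

/-- If `(Xₙ)` is a sequence of finite-dimensional normed spaces and `1 ≤ p < ∞`, then the
ℓᵖ-sum `(⊕ₙ Xₙ)_p` strictly-2^(1/p)-embeds into `c₀`. -/
theorem stmt11 (p : ENNReal) [Fact (1 ≤ p)] (hp : p ≠ ⊤)
    (X : ℕ → Type*) [∀ n, NormedAddCommGroup (X n)] [∀ n, NormedSpace ℝ (X n)]
    [∀ n, FiniteDimensional ℝ (X n)] :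
    ∃ f : lp X p → C₀(ℕ, ℝ), StrictEmbedding ((2 : ℝ) ^ (1 / p.toReal)) f := by
  have hp0 : 0 < p.toReal := ENNReal.toReal_pos (one_pos.trans_le Fact.out).ne' hp
  have hgap := exists_add_le_mul_dist_lpTruncation (X := X) hp
  set lam : ℝ := (2 : ℝ) ^ (1 / p.toReal) with hlam_def
  have hlam : 1 < lam := Real.one_lt_rpow one_lt_two (by positivity)
  have hlevel (n : ℕ) : ∃ (g : ℕ → lp X p → ℝ) (K : ℕ → ℝ≥0), (∀ i, (K i : ℝ) < lam) ∧
      (∀ i, LipschitzWith (K i) (g i)) ∧ (∃ N, ∀ i ≥ N, g i = 0) ∧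
      (∀ i z, |g i z| ≤ lam * lpTail n z + 1 / (n + 1)) ∧
      ∀ q ∈ lpLevel p X lam n, ∃ i, dist q.1 q.2 ≤ |g i q.1 - g i q.2| := by
    obtain ⟨c, hc, hgap⟩ := hgap n
    set R : ℝ := 2 * lam * (n + 1) / (lam - 1)
    have hR : ∀ q ∈ lpLevel p X lam n, ‖q.1‖ + ‖q.2‖ ≤ R := fun q hq =>
      norm_add_norm_le_of_mem_lpLevel hlam hq
    obtain ⟨C, hC, hPC⟩ := IsCompactOperator.image_closedBall_subset_compact
      (f := (lpTruncation p X (n + 1) : lp X p →ₗ[ℝ] lp X p))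
      (isCompactOperator_lpTruncation (p := p) (X := X) (n + 1)) R
    refine exists_finite_coordinates hlam (P := lpTruncation p X (n + 1)) ?_
      (lipschitzWith_lpTail hp n) (lpTail_nonneg n) (R := R) (by positivity) hc hC
      (fun q hq => ⟨hPC ⟨q.1, ?_, rfl⟩, hPC ⟨q.2, ?_, rfl⟩⟩)
      (fun q hq => ⟨(dist_le_norm_add_norm _ _).trans (hR q hq), ?_, ?_⟩) hgap
      fun q hq => hq.2
    · refine .of_dist_le_mul fun x y => ?_
      simpa [dist_eq_norm, ← map_sub] using norm_lpTruncation_le hp (n + 1) (x - y)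
    · rw [mem_closedBall_zero_iff]
      linarith [hR q hq, norm_nonneg q.2]
    · rw [mem_closedBall_zero_iff]
      linarith [hR q hq, norm_nonneg q.1]
    · linarith [hR q hq, norm_nonneg q.2, lpTail_le_norm hp n q.1]
    · linarith [hR q hq, norm_nonneg q.1, lpTail_le_norm hp n q.2]
  choose g K hK hg hfin hb hsep using hlevel
  refine exists_strictEmbedding_of_levels g K hK hg hfin
    (fun n z => lam * lpTail n z + 1 / (n + 1)) hb (fun x => ?_) fun x y hxy => ?_
  · simpa using ((tendsto_lpTail hp x).const_mul lam).add
      tendsto_one_div_add_atTop_nhds_zero_nat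
  · obtain ⟨n, hn⟩ := exists_mem_lpLevel hp hlam.le hxy
    obtain ⟨i, hi⟩ := hsep n (x, y) hn
    exact ⟨n, i, hi⟩
end

section
/- Let (M,d) be a metric space, U, V, F three nonempty subsets of M, and ε ≥ 0. Then there exists a 1-Lipschitz function f : M → ℝ such that: (1) |f(x)| ≤ ε for all x ∈ F; and (2) f(x) − f(y) = min{δ(U,V), δ(U,F) + δ(V,F) + 2ε} for all (x,y) ∈ U × V. -/
open Metric Set ZeroAtInfty

lemma setGap_nonneg {M : Type*} [MetricSpace M] (U V : Set M) : 0 ≤ setGap U V := by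
  apply Real.sInf_nonneg
  rintro _ ⟨p, -, rfl⟩
  exact dist_nonneg

lemma setGap_le_dist {M : Type*} [MetricSpace M] {U V : Set M} {u v : M}
    (hu : u ∈ U) (hv : v ∈ V) : setGap U V ≤ dist u v := by
  refine csInf_le ⟨0, ?_⟩ ⟨(u, v), ⟨hu, hv⟩, rfl⟩
  rintro _ ⟨p, -, rfl⟩
  exact dist_nonneg

lemma setGap_le_infDist_add_dist_add_infDist {M : Type*} [MetricSpace M] {U V : Set M}
    (hU : U.Nonempty) (hV : V.Nonempty) (x y : M) :
    setGap U V ≤ infDist x U + dist x y + infDist y V := by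
  have hxU : setGap U V - dist x y - infDist y V ≤ infDist x U := by
    refine (le_infDist hU).2 fun u hu => ?_
    have hyV : setGap U V - dist x y - dist x u ≤ infDist y V := by
      refine (le_infDist hV).2 fun v hv => ?_
      have h₁ := setGap_le_dist hu hv
      have h₂ := dist_triangle4 u x y v
      rw [dist_comm u x] at h₂
      linarith
    linarith
  linarith

lemma lipschitzWith_one_bump_sub_bump {M : Type*} [MetricSpace M] {U V : Set M}
    (hU : U.Nonempty) (hV : V.Nonempty) {a b : ℝ} (hab : a + b ≤ setGap U V) :
    LipschitzWith 1 fun x => max 0 (a - infDist x U) - max 0 (b - infDist x V) := by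
  refine LipschitzWith.of_le_add fun x y => ?_
  have h := setGap_le_infDist_add_dist_add_infDist hU hV x y
  have hyU : infDist y U ≤ infDist x U + dist x y := by
    simpa only [dist_comm] using infDist_le_infDist_add_dist (s := U) (x := y) (y := x)
  have hxV : infDist x V ≤ infDist y V + dist x y := infDist_le_infDist_add_dist
  have hd : 0 ≤ dist x y := dist_nonneg
  grind

/-- Lemma 4.5: given nonempty subsets `U, V, F` of `M` and `ε ≥ 0`, there is a 1-Lipschitz
function `f : M → ℝ` with `|f| ≤ ε` on `F` and
`f(x) - f(y) = min {δ(U,V), δ(U,F) + δ(V,F) + 2ε}` for `(x,y) ∈ U × V`. -/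
theorem stmt12 {M : Type*} [MetricSpace M] (U V F : Set M)
    (hU : U.Nonempty) (hV : V.Nonempty) (hF : F.Nonempty) (ε : ℝ) (hε : 0 ≤ ε) :
    ∃ f : M → ℝ, LipschitzWith 1 f ∧ (∀ x ∈ F, |f x| ≤ ε) ∧
      ∀ x ∈ U, ∀ y ∈ V,
        f x - f y = min (setGap U V) (setGap U F + setGap V F + 2 * ε) := by
  set m := min (setGap U V) (setGap U F + setGap V F + 2 * ε) with hm
  have hUV := setGap_nonneg U V
  have hUF := setGap_nonneg U F
  have hVF := setGap_nonneg V F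
  have hmUV : m ≤ setGap U V := min_le_left _ _
  have hmF : m ≤ setGap U F + setGap V F + 2 * ε := min_le_right _ _
  have hm₀ : 0 ≤ m := le_min hUV (by linarith)
  obtain ⟨a, b, hab, ha₀, hb₀, ha, hb⟩ : ∃ a b : ℝ, a + b = m ∧ 0 ≤ a ∧ 0 ≤ b ∧
      a ≤ setGap U F + ε ∧ b ≤ setGap V F + ε :=
    ⟨min m (setGap U F + ε), m - min m (setGap U F + ε), by ring,
      le_min hm₀ (by linarith), sub_nonneg.2 (min_le_left _ _), min_le_right _ _, by grind⟩
  refine ⟨_, lipschitzWith_one_bump_sub_bump hU hV (hab.trans_le hmUV), fun x hx => ?_,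
    fun x hx y hy => ?_⟩
  · have h₁ := setGap_le_infDist_add_dist_add_infDist hU hF x x
    have h₂ := setGap_le_infDist_add_dist_add_infDist hV hF x x
    rw [dist_self, infDist_zero_of_mem hx] at h₁ h₂
    grind
  · have h₁ := setGap_le_infDist_add_dist_add_infDist hU hV x x
    have h₂ := setGap_le_infDist_add_dist_add_infDist hU hV y y
    rw [dist_self, infDist_zero_of_mem hx] at h₁
    rw [dist_self, infDist_zero_of_mem hy] at h₂
    simp only [infDist_zero_of_mem hx, infDist_zero_of_mem hy]
    grind
end
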